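/- arXiv:1805.01997 — 3 statements merged into one kernel-verified Lean document; each statement's English description precedes it below -/
import Mathlib

section
/- Let n ≥ 1, let D ⊆ ℝⁿ be a nonempty open convex set, and let f : D → ℝ be a mid-convex function. Suppose there exist a set S ⊆ D that is locally connected in its subspace topology and nowhere flat in ℝⁿ, and an analytic set A ⊆ S that is non-meager in the subspace S, such that f is bounded above on A (i.e., f(A) is bounded above in ℝ). Then f is continuous on D. -/
/-- A set `K ⊆ ℝⁿ` is nowhere flat if every nonempty relatively open subset of `K`
has affine span equal to all of `ℝⁿ`. -/
def NowhereFlat {n : ℕ} (K : Set (Fin n → ℝ)) : Prop :=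
  ∀ V : Set (Fin n → ℝ), IsOpen V → (V ∩ K).Nonempty → affineSpan ℝ (V ∩ K) = ⊤

open AddMonoidAlgebra
open scoped Pointwise Topology

/-- The span of the monomials with exponents in `T`. -/
noncomputable def monomialSpan {G : Type*} [AddCommGroup G] (T : Set G) : Submodule ℤ (AddMonoidAlgebra ℤ G) :=
  Submodule.span ℤ ((fun g => single g (1 : ℤ)) '' T)

lemma single_mem_monomialSpan {G : Type*} [AddCommGroup G] {T : Set G} {g : G} (hg : g ∈ T) :
    (single g (1 : ℤ)) ∈ monomialSpan T :=
  Submodule.subset_span ⟨g, hg, rfl⟩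

lemma monomialSpan_mono {G : Type*} [AddCommGroup G] {T T' : Set G} (h : T ⊆ T') :
    monomialSpan T ≤ monomialSpan T' :=
  Submodule.span_mono (Set.image_mono h)

lemma mem_of_mem_monomialSpan {G : Type*} [AddCommGroup G] {T : Set G}
    {a : AddMonoidAlgebra ℤ G} (ha : a ∈ monomialSpan T) {g : G} (hg : a.coeff g ≠ 0) : g ∈ T := by
  classical
  by_contra hgT
  refine hg ?_
  clear hg
  induction ha using Submodule.span_induction with
  | mem x hx =>
    obtain ⟨t, ht, rfl⟩ := hx
    have : t ≠ g := fun h => hgT (h ▸ ht)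
    simp [coeff_single, this]
  | zero => simp
  | add x y _ _ hx hy => simp [hx, hy]
  | smul c x _ hx => rw [coeff_smul, Finsupp.smul_apply, hx, smul_zero]

lemma prod_mem_monomialSpan {G ι : Type*} [AddCommGroup G] {T : ι → Set G}
    {a : ι → AddMonoidAlgebra ℤ G} (ha : ∀ i, a i ∈ monomialSpan (T i)) (s : Finset ι) :
    ∏ i ∈ s, a i ∈ monomialSpan {g | ∃ t : ι → G, (∀ i ∈ s, t i ∈ T i) ∧ g = ∑ i ∈ s, t i} := by
  classical
  induction s using Finset.induction_on with
  | empty =>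
    rw [Finset.prod_empty, AddMonoidAlgebra.one_def]
    exact single_mem_monomialSpan ⟨0, by simp, by simp⟩
  | insert j s hj ih =>
    rw [Finset.prod_insert hj]
    have := Submodule.mul_mem_mul (ha j) ih
    rw [monomialSpan, monomialSpan, Submodule.span_mul_span] at this
    refine Submodule.span_mono ?_ this
    rintro _ ⟨_, ⟨u, hu, rfl⟩, _, ⟨_, ⟨t, ht, rfl⟩, rfl⟩, rfl⟩
    refine ⟨u + ∑ i ∈ s, t i, ⟨Function.update t j u, ?_, ?_⟩, ?_⟩
    · intro i hi
      by_cases h : i = j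
      · subst h; simpa using hu
      · simpa [h] using ht i ((Finset.mem_insert.1 hi).resolve_left h)
    · rw [Finset.sum_insert hj, Function.update_self]
      congr 1
      refine Finset.sum_congr rfl fun i hi => ?_
      rw [Function.update_of_ne (ne_of_mem_of_not_mem hi hj)]
    · simp [single_mul_single]

/-- The augmentation map of an integral group ring. -/
noncomputable def augmentation (G : Type*) [AddCommGroup G] : AddMonoidAlgebra ℤ G →+* ℤ :=
  (AddMonoidAlgebra.lift ℤ ℤ G 1 : AddMonoidAlgebra ℤ G →ₐ[ℤ] ℤ)

@[simp] lemma augmentation_single {G : Type*} [AddCommGroup G] (g : G) :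
    augmentation G (single g 1) = 1 := by
  simp [augmentation]

lemma eq_zero_of_forall_single_mul {n N : ℕ} [NeZero N]
    {d : AddMonoidAlgebra ℤ (Fin n → ZMod N)}
    (h : ∀ l, single (Pi.single l 1) 1 * d = d) {g : Fin n → ZMod N} (hg : d.coeff g = 0) :
    d = 0 := by
  let H : AddSubmonoid (Fin n → ZMod N) :=
    { carrier := {y | single y 1 * d = d}
      zero_mem' := by
        change single 0 1 * d = d
        rw [← AddMonoidAlgebra.one_def, one_mul]
      add_mem' := by
        intro a b (ha : single a 1 * d = d) (hb : single b 1 * d = d)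
        change single (a + b) 1 * d = d
        have : (single (a + b) 1 : AddMonoidAlgebra ℤ (Fin n → ZMod N))
          = single a 1 * single b 1 := by rw [single_mul_single, one_mul]
        rw [this, mul_assoc, hb, ha] }
  have hH : ∀ y, y ∈ H := by
    intro y
    have : y = ∑ l, (y l).val • (Pi.single l 1 : Fin n → ZMod N) := by
      ext k
      simp only [Finset.sum_apply, Pi.smul_apply, Pi.single_apply]
      simp
    rw [this]
    exact H.sum_mem fun l _ => H.nsmul_mem (h l) _
  ext y
  have h2 : single (y - g) 1 * d = d := hH (y - g)
  rw [← h2, coeff_single_mul_apply]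
  simp [hg]

lemma coeff_det_ne_zero {n N : ℕ} [NeZero N]
    (M : Matrix (Fin n) (Fin n) (AddMonoidAlgebra ℤ (Fin n → ZMod N)))
    (hM : ∀ i, ∑ l, M i l * (single (Pi.single l 1) 1 - 1) = 0)
    (haug : ∀ i l, augmentation _ (M i l) = if i = l then (N : ℤ) else 0) (g : Fin n → ZMod N) :
    M.det.coeff g ≠ 0 := by
  intro hg
  have h0 : M.det = 0 := by
    refine eq_zero_of_forall_single_mul (fun l => ?_) hg
    have h1 : M.mulVec (fun l => single (Pi.single l 1) 1 - 1) = 0 := by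
      ext1 i
      exact hM i
    have h2 : (M.adjugate * M).mulVec (fun l => single (Pi.single l 1) 1 - 1) = 0 := by
      rw [← Matrix.mulVec_mulVec, h1, Matrix.mulVec_zero]
    rw [Matrix.adjugate_mul] at h2
    have h3 := congrFun h2 l
    rw [Matrix.smul_mulVec, Matrix.one_mulVec] at h3
    simp only [Pi.smul_apply, smul_eq_mul, Pi.zero_apply, mul_sub, mul_one] at h3
    rw [mul_comm]
    exact sub_eq_zero.1 h3
  have h1 : (augmentation _) M.det = (N : ℤ) ^ n := by
    rw [RingHom.map_det]
    have : (augmentation _).mapMatrix M = Matrix.diagonal (fun _ => (N : ℤ)) := by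
      ext i l
      simp [haug, Matrix.diagonal_apply]
    rw [this, Matrix.det_diagonal]
    simp
  rw [h0, map_zero] at h1
  exact pow_ne_zero n (Nat.cast_ne_zero.2 (NeZero.ne N)) h1.symm

lemma exists_eq_sum_of_cycles {n N : ℕ} [NeZero N] (T : Fin n → Set (Fin n → ZMod N))
    (M : Matrix (Fin n) (Fin n) (AddMonoidAlgebra ℤ (Fin n → ZMod N)))
    (hT : ∀ i l, M i l ∈ monomialSpan (T i))
    (hM : ∀ i, ∑ l, M i l * (single (Pi.single l 1) 1 - 1) = 0)
    (haug : ∀ i l, augmentation _ (M i l) = if i = l then (N : ℤ) else 0) (g : Fin n → ZMod N) :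
    ∃ t : Fin n → Fin n → ZMod N, (∀ i, t i ∈ T i) ∧ g = ∑ i, t i := by
  have hdet : M.det ∈ monomialSpan
      {g | ∃ t : Fin n → Fin n → ZMod N, (∀ i ∈ Finset.univ, t i ∈ T i) ∧
        g = ∑ i ∈ Finset.univ, t i} := by
    rw [← Matrix.det_transpose, Matrix.det_apply]
    refine Submodule.sum_mem _ fun σ _ => ?_
    rw [Units.smul_def]
    exact Submodule.smul_mem _ _ (prod_mem_monomialSpan (fun i => hT i (σ i)) _)
  obtain ⟨t, ht, hg⟩ := mem_of_mem_monomialSpan hdet (coeff_det_ne_zero M hM haug g)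
  exact ⟨t, fun i => ht i (Finset.mem_univ i), hg⟩

/-- `v` is a `1`-chain of edges of the grid `(ℤ / N)ⁿ` starting in `T`, with boundary `b - a` and
total displacement `z`. -/
def IsGridChain {n N : ℕ} (T : Set (Fin n → ZMod N)) (a b : Fin n → ZMod N)
    (z : Fin n → ℤ) (v : Fin n → AddMonoidAlgebra ℤ (Fin n → ZMod N)) : Prop :=
  (∀ l, v l ∈ monomialSpan T) ∧
    ∑ l, v l * (single (Pi.single l 1) 1 - 1) = single b 1 - single a 1 ∧
    ∀ l, augmentation _ (v l) = z l

lemma IsGridChain.mono {n N : ℕ} {T T' : Set (Fin n → ZMod N)} {a b : Fin n → ZMod N}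
    {z : Fin n → ℤ} {v : Fin n → AddMonoidAlgebra ℤ (Fin n → ZMod N)}
    (h : IsGridChain T a b z v) (hT : T ⊆ T') : IsGridChain T' a b z v :=
  ⟨fun l => monomialSpan_mono hT (h.1 l), h.2⟩

lemma IsGridChain.neg {n N : ℕ} {T : Set (Fin n → ZMod N)} {a b : Fin n → ZMod N}
    {z : Fin n → ℤ} {v : Fin n → AddMonoidAlgebra ℤ (Fin n → ZMod N)}
    (h : IsGridChain T a b z v) : IsGridChain T b a (-z) (-v) := by
  refine ⟨fun l => Submodule.neg_mem _ (h.1 l), ?_, fun l => ?_⟩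
  · simp only [Pi.neg_apply, neg_mul, Finset.sum_neg_distrib]
    rw [h.2.1, neg_sub]
  · simp [h.2.2 l]

lemma IsGridChain.add {n N : ℕ} {T : Set (Fin n → ZMod N)} {a b c : Fin n → ZMod N}
    {z w : Fin n → ℤ} {u v : Fin n → AddMonoidAlgebra ℤ (Fin n → ZMod N)}
    (hu : IsGridChain T a b z u) (hv : IsGridChain T b c w v) :
    IsGridChain T a c (z + w) (u + v) := by
  refine ⟨fun l => Submodule.add_mem _ (hu.1 l) (hv.1 l), ?_, fun l => ?_⟩
  · simp only [Pi.add_apply, add_mul, Finset.sum_add_distrib]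
    rw [hu.2.1, hv.2.1]
    abel
  · simp [hu.2.2 l, hv.2.2 l]

lemma isGridChain_zero {n N : ℕ} (T : Set (Fin n → ZMod N)) (a : Fin n → ZMod N) :
    IsGridChain T a a 0 0 :=
  ⟨fun _ => Submodule.zero_mem _, by simp, by simp⟩

lemma isGridChain_edge {n N : ℕ} {T : Set (Fin n → ZMod N)} {a : Fin n → ZMod N} (ha : a ∈ T)
    (j : Fin n) :
    IsGridChain T a (a + Pi.single j 1) (Pi.single j 1) (Pi.single j (single a 1)) := by
  refine ⟨fun l => ?_, ?_, fun l => ?_⟩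
  · by_cases h : l = j
    · subst h
      simpa using single_mem_monomialSpan ha
    · simp [h]
  · rw [Finset.sum_eq_single j (fun l _ h => by simp [h]) (by simp)]
    simp [mul_sub, single_mul_single]
  · by_cases h : l = j
    · subst h
      simp
    · simp [h]

lemma exists_isGridChain_line {n N : ℕ} {T : Set (Fin n → ZMod N)} {a : Fin n → ZMod N}
    (j : Fin n) {z : ℤ} (hz : |z| ≤ 1) (ha : a ∈ T) (hb : a + Pi.single j (z : ZMod N) ∈ T) :
    ∃ v, IsGridChain T a (a + Pi.single j (z : ZMod N)) (Pi.single j z) v := by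
  rw [abs_le] at hz
  obtain rfl | rfl | rfl : z = 0 ∨ z = 1 ∨ z = -1 := by omega
  · exact ⟨0, by simpa using isGridChain_zero T a⟩
  · exact ⟨_, by simpa using isGridChain_edge ha j⟩
  · have h := (isGridChain_edge hb j).neg
    rw [add_assoc, ← Pi.single_add, Int.cast_neg, Int.cast_one, neg_add_cancel, Pi.single_zero,
      add_zero, ← Pi.single_neg] at h
    rw [Int.cast_neg, Int.cast_one]
    exact ⟨_, h⟩

lemma exists_isGridChain_of_abs_le_one {n N : ℕ} (a : Fin n → ZMod N) {z : Fin n → ℤ}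
    (hz : ∀ l, |z l| ≤ 1) :
    ∃ v, IsGridChain {y | ∃ d : Fin n → ℤ, (∀ l, |d l| ≤ 1) ∧ y = fun l => a l + (d l : ZMod N)}
      a (fun l => a l + (z l : ZMod N)) z v := by
  set T : Set (Fin n → ZMod N) :=
    {y | ∃ d : Fin n → ℤ, (∀ l, |d l| ≤ 1) ∧ y = fun l => a l + (d l : ZMod N)}
  let ζ : Finset (Fin n) → Fin n → ℤ := fun s l => if l ∈ s then z l else 0
  have hmem : ∀ s, (fun l => a l + (ζ s l : ZMod N)) ∈ T := fun s => by
    refine ⟨ζ s, fun l => ?_, rfl⟩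
    by_cases h : l ∈ s
    · simpa [ζ, h] using hz l
    · simp [ζ, h]
  have key : ∀ s, ∃ v, IsGridChain T a (fun l => a l + (ζ s l : ZMod N)) (ζ s) v := by
    intro s
    induction s using Finset.induction_on with
    | empty => exact ⟨0, by convert isGridChain_zero T a using 1 <;> ext <;> simp [ζ]⟩
    | insert j s hj ih =>
      obtain ⟨v, hv⟩ := ih
      have h1 : ζ (insert j s) = ζ s + Pi.single j (z j) := by
        ext l
        by_cases h : l = j
        · subst h; simp [ζ, hj]
        · simp [ζ, h]
      have h2 : (fun l => a l + (ζ (insert j s) l : ZMod N)) =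
          (fun l => a l + (ζ s l : ZMod N)) + Pi.single j (z j : ZMod N) := by
        ext l
        rw [h1]
        by_cases h : l = j
        · subst h; simp [add_assoc]
        · simp [h]
      have hb := hmem (insert j s)
      rw [h2] at hb ⊢
      obtain ⟨w, hw⟩ := exists_isGridChain_line j (hz j) (hmem s) hb
      rw [h1]
      exact ⟨_, hv.add hw⟩
  simpa [ζ] using key Finset.univ

/-- The class modulo `N` of the grid point obtained by rounding down `N • x`. -/
noncomputable def gridPoint {n : ℕ} (N : ℕ) (x : Fin n → ℝ) : Fin n → ZMod N :=
  fun l => ((⌊(N : ℝ) * x l⌋ : ℤ) : ZMod N)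

/-- The grid points, modulo `N`, at distance at most one grid step from the rounding of `C`. -/
def gridNear {n : ℕ} (N : ℕ) (C : Set (Fin n → ℝ)) : Set (Fin n → ZMod N) :=
  {g | ∃ c ∈ C, ∃ d : Fin n → ℤ, (∀ l, |d l| ≤ 1) ∧ g = fun l => gridPoint N c l + (d l : ZMod N)}

lemma exists_isGridChain_of_isPreconnected {n N : ℕ} [NeZero N] {C : Set (Fin n → ℝ)}
    (hC : IsPreconnected C) {a b : Fin n → ℝ} (ha : a ∈ C) (hb : b ∈ C) :
    ∃ v, IsGridChain (gridNear N C) (gridPoint N a) (gridPoint N b)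
      (fun l => ⌊(N : ℝ) * b l⌋ - ⌊(N : ℝ) * a l⌋) v := by
  have hN : (0 : ℝ) < N := Nat.cast_pos.2 (Nat.pos_of_ne_zero (NeZero.ne N))
  refine hC.induction₂ (fun a b => ∃ v, IsGridChain (gridNear N C) (gridPoint N a) (gridPoint N b)
      (fun l => ⌊(N : ℝ) * b l⌋ - ⌊(N : ℝ) * a l⌋) v) ?_ ?_ ?_ ha hb
  · intro x hx
    filter_upwards [nhdsWithin_le_nhds (Metric.ball_mem_nhds x (inv_pos.2 hN))] with y hy
    have hz : ∀ l, |⌊(N : ℝ) * y l⌋ - ⌊(N : ℝ) * x l⌋| ≤ 1 := by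
      intro l
      have h1 : |y l - x l| < (N : ℝ)⁻¹ := (dist_le_pi_dist y x l).trans_lt hy
      have h2 : |(N : ℝ) * y l - N * x l| < 1 := by
        rw [← mul_sub, abs_mul, abs_of_pos hN]
        calc (N : ℝ) * |y l - x l| < N * (N : ℝ)⁻¹ := by gcongr
          _ = 1 := mul_inv_cancel₀ hN.ne'
      rw [← Int.lt_add_one_iff]
      have h3 := abs_lt.1 h2
      have h4 : (|⌊(N : ℝ) * y l⌋ - ⌊(N : ℝ) * x l⌋| : ℝ) < 1 + 1 := by
        rw [abs_lt]
        constructor <;>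
          linarith [Int.floor_le ((N : ℝ) * y l), Int.lt_floor_add_one ((N : ℝ) * y l),
            Int.floor_le ((N : ℝ) * x l), Int.lt_floor_add_one ((N : ℝ) * x l)]
      exact_mod_cast h4
    obtain ⟨v, hv⟩ := exists_isGridChain_of_abs_le_one (gridPoint N x) hz
    have h5 : (fun l => gridPoint N x l + ((⌊(N : ℝ) * y l⌋ - ⌊(N : ℝ) * x l⌋ : ℤ) : ZMod N)) =
        gridPoint N y := by
      ext l
      simp [gridPoint]
    rw [h5] at hv
    exact ⟨v, hv.mono fun g ⟨d, hd, hg⟩ => ⟨x, hx, d, hd, hg⟩⟩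
  · rintro x y z _ _ _ ⟨u, hu⟩ ⟨v, hv⟩
    refine ⟨u + v, ?_⟩
    convert hu.add hv using 1
    ext l
    simp
  · rintro x y _ _ ⟨v, hv⟩
    refine ⟨-v, ?_⟩
    convert hv.neg using 1
    ext l
    simp

lemma exists_sum_near_modulo_lattice {n : ℕ} {C : Fin n → Set (Fin n → ℝ)}
    (hC : ∀ i, IsPreconnected (C i)) (h0 : ∀ i, 0 ∈ C i) (h1 : ∀ i, Pi.single i 1 ∈ C i)
    (N : ℕ) [NeZero N] (x : Fin n → ℝ) :
    ∃ c : Fin n → Fin n → ℝ, (∀ i, c i ∈ C i) ∧ ∃ m : Fin n → ℤ,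
      ∀ l, |x l - (m l + ∑ i, c i l)| ≤ (2 * n + 1) / N := by
  have hN : (0 : ℝ) < N := Nat.cast_pos.2 (Nat.pos_of_ne_zero (NeZero.ne N))
  choose M hMT hM haug using fun i =>
    exists_isGridChain_of_isPreconnected (N := N) (hC i) (h0 i) (h1 i)
  have hp0 : gridPoint N (0 : Fin n → ℝ) = 0 := by
    ext l
    simp [gridPoint]
  have hp1 : ∀ i, gridPoint N (Pi.single i 1 : Fin n → ℝ) = 0 := by
    intro i
    ext l
    by_cases h : l = i
    · subst h; simp [gridPoint]
    · simp [gridPoint, h]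
  obtain ⟨t, ht, hg⟩ := exists_eq_sum_of_cycles (fun i => gridNear N (C i)) M hMT
    (fun i => by rw [hM, hp0, hp1, sub_self])
    (fun i l => by
      rw [haug]
      by_cases h : l = i
      · subst h; simp
      · simp [h, Ne.symm h]) (gridPoint N x)
  choose c hc d hd htd using ht
  have hdvd : ∀ l, (N : ℤ) ∣ ⌊(N : ℝ) * x l⌋ - ∑ i, (⌊(N : ℝ) * c i l⌋ + d i l) := by
    intro l
    rw [← ZMod.intCast_zmod_eq_zero_iff_dvd]
    have := congrFun hg l
    simp only [Finset.sum_apply, htd, gridPoint] at this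
    push_cast
    rw [this, sub_self]
  choose m hm using hdvd
  refine ⟨c, hc, m, fun l => ?_⟩
  have hm' : (⌊(N : ℝ) * x l⌋ : ℝ) - ∑ i, ((⌊(N : ℝ) * c i l⌋ : ℝ) + d i l) = N * m l := by
    exact_mod_cast hm l
  have e : x l - (m l + ∑ i, c i l) = (((N : ℝ) * x l - ⌊(N : ℝ) * x l⌋) +
      ∑ i, (d i l - ((N : ℝ) * c i l - ⌊(N : ℝ) * c i l⌋))) / N := by
    rw [eq_div_iff hN.ne']
    simp only [Finset.sum_sub_distrib, Finset.sum_add_distrib, ← Finset.mul_sum] at hm' ⊢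
    linear_combination hm'
  have hfl : ∀ y : ℝ, |y - ⌊y⌋| ≤ 1 := fun y => by
    rw [abs_le]
    constructor <;> linarith [Int.floor_le y, Int.lt_floor_add_one y]
  rw [e, abs_div, abs_of_pos hN]
  gcongr
  refine (abs_add_le _ _).trans ?_
  rw [add_comm]
  refine add_le_add ((Finset.abs_sum_le_sum_abs _ _).trans ?_) (hfl _)
  have : ∀ i ∈ Finset.univ, |(d i l : ℝ) - ((N : ℝ) * c i l - ⌊(N : ℝ) * c i l⌋)| ≤ 2 := by
    intro i _
    have h1 : |(d i l : ℝ)| ≤ 1 := by exact_mod_cast hd i l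
    linarith [abs_sub (d i l : ℝ) ((N : ℝ) * c i l - ⌊(N : ℝ) * c i l⌋), hfl ((N : ℝ) * c i l)]
  refine (Finset.sum_le_card_nsmul _ _ _ this).trans ?_
  simp [mul_comm]

lemma interior_sum_closure_nonempty_of_single_mem {n : ℕ} {C : Fin n → Set (Fin n → ℝ)}
    (hC : ∀ i, IsPreconnected (C i)) (hb : ∀ i, Bornology.IsBounded (C i))
    (h0 : ∀ i, 0 ∈ C i) (h1 : ∀ i, Pi.single i 1 ∈ C i) :
    (interior (closure ((fun c : Fin n → Fin n → ℝ => ∑ i, c i) '' Set.univ.pi C))).Nonempty := by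
  have hcont : Continuous (fun c : Fin n → Fin n → ℝ => ∑ i, c i) := by fun_prop
  set K := (fun c : Fin n → Fin n → ℝ => ∑ i, c i) '' (Set.univ.pi fun i => closure (C i)) with hK
  have hKc : IsCompact K :=
    (isCompact_univ_pi fun i => (hb i).isCompact_closure).image hcont
  let Z : Set (Fin n → ℝ) := Set.univ.pi fun _ => Set.range ((↑) : ℤ → ℝ)
  have hZ : IsClosed Z := isClosed_set_pi fun _ _ => Int.isClosedEmbedding_coe_real.isClosed_range
  have hclosed : IsClosed (Z + K) := hZ.add_right_of_isCompact hKc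
  have huniv : Z + K = Set.univ := by
    rw [← hclosed.closure_eq, Set.eq_univ_iff_forall]
    intro x
    rw [Metric.mem_closure_iff]
    intro ε hε
    obtain ⟨N, hN⟩ := exists_nat_gt ((2 * n + 1) / ε)
    have hNpos : (0 : ℝ) < N := lt_of_le_of_lt (by positivity) hN
    have : NeZero N := ⟨by rintro rfl; simp at hNpos⟩
    obtain ⟨c, hc, m, hm⟩ := exists_sum_near_modulo_lattice hC h0 h1 N x
    refine ⟨_, Set.add_mem_add (a := fun l => (m l : ℝ)) (fun l _ => ⟨m l, rfl⟩)
      ⟨c, fun i _ => subset_closure (hc i), rfl⟩, ?_⟩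
    refine (dist_pi_lt_iff hε).2 fun l => ?_
    rw [Real.dist_eq]
    simp only [Pi.add_apply, Finset.sum_apply]
    refine (hm l).trans_lt ?_
    rw [div_lt_iff₀ hε] at hN
    rwa [div_lt_iff₀ hNpos, mul_comm ε]
  have hcover : ⋃ m : Fin n → ℤ, (fun y => (fun l => (m l : ℝ)) + y) '' K = Set.univ := by
    rw [Set.eq_univ_iff_forall]
    intro x
    obtain ⟨z, hz, k, hk, rfl⟩ := huniv.symm ▸ Set.mem_univ x
    choose m hm using fun l => hz l (Set.mem_univ l)
    obtain rfl : (fun l => (m l : ℝ)) = z := funext hm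
    exact Set.mem_iUnion.2 ⟨m, k, hk, rfl⟩
  obtain ⟨m, hm⟩ := nonempty_interior_of_iUnion_of_closed
    (fun m => (hKc.image (continuous_const_add _)).isClosed) hcover
  have e := (Homeomorph.addLeft (fun l => (m l : ℝ))).image_interior K
  rw [Homeomorph.coe_addLeft] at e
  rw [← e, Set.image_nonempty] at hm
  refine hm.mono (interior_mono ?_)
  rw [hK, ← closure_pi_set]
  exact image_closure_subset_closure_image hcont

lemma exists_linearIndependent_transversal {E : Type*} [AddCommGroup E] [Module ℝ E]
    [FiniteDimensional ℝ E] {k : ℕ} (hk : k ≤ Module.finrank ℝ E) (V : Fin k → Set E)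
    (hV : ∀ i, Submodule.span ℝ (V i) = ⊤) :
    ∃ w : Fin k → E, (∀ i, w i ∈ V i) ∧ LinearIndependent ℝ w := by
  induction k with
  | zero => exact ⟨Fin.elim0, fun i => i.elim0, linearIndependent_empty_type⟩
  | succ k ih =>
    obtain ⟨w, hw, hli⟩ := ih (by omega) (fun i => V i.castSucc) (fun i => hV _)
    have hne : ¬ V (Fin.last k) ⊆ Submodule.span ℝ (Set.range w) := by
      intro hsub
      have htop : Submodule.span ℝ (Set.range w) = ⊤ :=
        top_unique ((hV (Fin.last k)).symm.le.trans (Submodule.span_le.2 hsub))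
      have := finrank_range_le_card (R := ℝ) w
      rw [Set.finrank, htop, finrank_top, Fintype.card_fin] at this
      omega
    obtain ⟨x, hx, hxs⟩ := Set.not_subset.1 hne
    refine ⟨Fin.snoc (α := fun _ => E) w x, fun i => ?_, linearIndependent_finSnoc.2 ⟨hli, hxs⟩⟩
    refine Fin.lastCases ?_ (fun i => ?_) i
    · simpa using hx
    · simpa using hw i

lemma interior_closure_sum_nonempty {n : ℕ} {C : Fin n → Set (Fin n → ℝ)}
    (hC : ∀ i, IsPreconnected (C i)) (hb : ∀ i, Bornology.IsBounded (C i))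
    (hspan : ∀ i, affineSpan ℝ (C i) = ⊤) :
    (interior (closure ((fun c : Fin n → Fin n → ℝ => ∑ i, c i) '' Set.univ.pi C))).Nonempty := by
  obtain ⟨w, hw, hli⟩ := exists_linearIndependent_transversal (E := Fin n → ℝ) (k := n) (by simp)
    (fun i => C i -ᵥ C i) (fun i => by
      rw [← vectorSpan_def, ← direction_affineSpan, hspan i, AffineSubspace.direction_top])
  choose b hbC a ha hba using hw
  let B := Module.Basis.mk hli (hli.span_eq_top_of_card_eq_finrank' (by simp)).ge
  have hB : ⇑B = w := Module.Basis.coe_mk _ _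
  let L : (Fin n → ℝ) ≃L[ℝ] (Fin n → ℝ) := B.equivFun.toContinuousLinearEquiv
  have hL : ∀ i, L (b i - a i) = Pi.single i 1 := by
    intro i
    have : b i - a i = B i := by rw [hB, ← hba i]; rfl
    rw [this]
    ext l
    simp [L, Pi.single_apply, eq_comm]
  let h : (Fin n → ℝ) ≃ₜ (Fin n → ℝ) :=
    (Homeomorph.addRight (-∑ i, a i)).trans L.toHomeomorph
  have key := interior_sum_closure_nonempty_of_single_mem
    (C := fun i => (fun x => L (x - a i)) '' C i)
    (fun i => (hC i).image _ (by fun_prop))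
    (fun i => by
      have : (fun x => L (x - a i)) '' C i ⊆ (fun x => L (x - a i)) '' closure (C i) :=
        Set.image_mono subset_closure
      exact ((hb i).isCompact_closure.image (by fun_prop)).isBounded.subset this)
    (fun i => ⟨a i, ha i, by simp⟩) (fun i => ⟨b i, hbC i, hL i⟩)
  have e : (fun c : Fin n → Fin n → ℝ => ∑ i, c i) ''
      (Set.univ.pi fun i => (fun x => L (x - a i)) '' C i) =
      h '' ((fun c : Fin n → Fin n → ℝ => ∑ i, c i) '' Set.univ.pi C) := by
    have hh : ∀ c : Fin n → Fin n → ℝ, h (∑ i, c i) = ∑ i, L (c i - a i) := by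
      intro c
      rw [← map_sum, Finset.sum_sub_distrib, sub_eq_add_neg]
      rfl
    ext y
    constructor
    · rintro ⟨c, hc, rfl⟩
      choose c' hc' hcc using fun i => hc i (Set.mem_univ i)
      exact ⟨_, ⟨c', fun i _ => hc' i, rfl⟩, by simp only [hh, hcc]⟩
    · rintro ⟨_, ⟨c, hc, rfl⟩, rfl⟩
      exact ⟨fun i => L (c i - a i), fun i _ => ⟨c i, hc i (Set.mem_univ i), rfl⟩, (hh c).symm⟩
  rw [e, ← h.image_closure, ← h.image_interior, Set.image_nonempty] at key
  exact key

lemma exists_tendsto_of_shrinking {Q E : Type*} [MetricSpace Q] [CompleteSpace Q]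
    [TopologicalSpace E] [RegularSpace E] {ψ : Q → E} (hψ : Continuous ψ) {W : ℕ → Set Q}
    (hW : ∀ k, closure (W (k + 1)) ⊆ W k)
    (hball : ∀ k : ℕ, ∃ v, closure (W (k + 1)) ⊆ Metric.closedBall v (1 / ((k : ℝ) + 1)))
    {y : ℕ → E} (hy : ∀ k, y k ∈ closure (ψ '' W k)) :
    ∃ q, Filter.Tendsto y Filter.atTop (𝓝 (ψ q)) := by
  choose v hv using hball
  have hne : ∀ k, (W k).Nonempty := fun k => by
    have := closure_nonempty_iff.1 ⟨y k, hy k⟩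
    simpa using this
  have hanti : Antitone W := antitone_nat_of_succ_le fun k => subset_closure.trans (hW k)
  have hdiam : ∀ k, Metric.diam (closure (W (k + 1))) ≤ 2 * (1 / ((k : ℝ) + 1)) := fun k =>
    (Metric.diam_mono (hv k) Metric.isBounded_closedBall).trans
      (Metric.diam_closedBall (by positivity))
  have hlim : Filter.Tendsto (fun k : ℕ => 2 * (1 / ((k : ℝ) + 1))) Filter.atTop (𝓝 0) := by
    simpa using tendsto_one_div_add_atTop_nhds_zero_nat.const_mul (2 : ℝ)
  obtain ⟨q, hq⟩ := Metric.nonempty_iInter_of_nonempty_biInter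
    (s := fun k => closure (W (k + 1))) (fun _ => isClosed_closure)
    (fun k => Metric.isBounded_closedBall.subset (hv k))
    (fun N => (hne (N + 1)).mono fun x hx =>
      Set.mem_iInter₂.2 fun k hk => subset_closure (hanti (by omega) hx))
    (squeeze_zero (fun _ => Metric.diam_nonneg) hdiam hlim)
  rw [Set.mem_iInter] at hq
  refine ⟨q, (Filter.tendsto_add_atTop_iff_nat 1).1
    ((closed_nhds_basis (ψ q)).tendsto_right_iff.2 ?_)⟩
  rintro F ⟨hF, hFc⟩
  obtain ⟨ε, hε, hεF⟩ := Metric.mem_nhds_iff.1 (hψ.continuousAt.preimage_mem_nhds hF)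
  filter_upwards [hlim.eventually (gt_mem_nhds hε)] with k hk
  refine closure_minimal ?_ hFc (hy (k + 1))
  rintro _ ⟨x, hx, rfl⟩
  refine hεF ?_
  rw [Metric.mem_ball]
  calc dist x q ≤ dist x (v k) + dist q (v k) := dist_triangle_right _ _ _
    _ ≤ 1 / ((k : ℝ) + 1) + 1 / ((k : ℝ) + 1) :=
        add_le_add (hv k (subset_closure hx)) (hv k (hq k))
    _ < ε := by linarith

lemma exists_smaller_open {Q E : Type*} [MetricSpace Q] [TopologicalSpace E] {ψ : Q → E}
    (hψ : Continuous ψ)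
    (hopen : ∀ U : Set Q, IsOpen U → U.Nonempty → (interior (closure (ψ '' U))).Nonempty)
    {V : Set Q} (hV : IsOpen V) {T : Set E} (hT : IsOpen T)
    (h : (T ∩ closure (ψ '' V)).Nonempty) {ε : ℝ} (hε : 0 < ε) :
    ∃ V' : Set Q, IsOpen V' ∧ closure V' ⊆ V ∧ (∃ v, closure V' ⊆ Metric.closedBall v ε) ∧
      (T ∩ interior (closure (ψ '' V'))).Nonempty := by
  obtain ⟨y, hyT, hyV⟩ := h
  obtain ⟨_, hvT, v, hv, rfl⟩ := mem_closure_iff.1 hyV T hT hyT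
  obtain ⟨r, hr, hrV⟩ := Metric.nhds_basis_closedBall.mem_iff.1
    (Filter.inter_mem (hV.mem_nhds hv) (hψ.continuousAt.preimage_mem_nhds (hT.mem_nhds hvT)))
  set s := min r ε
  have hs : 0 < s := lt_min hr hε
  have hcl : closure (Metric.ball v s) ⊆ Metric.closedBall v s := Metric.closure_ball_subset_closedBall
  have hsub : Metric.ball v s ⊆ V ∩ ψ ⁻¹' T :=
    Metric.ball_subset_closedBall.trans
      ((Metric.closedBall_subset_closedBall (min_le_left _ _)).trans hrV)
  refine ⟨Metric.ball v s, Metric.isOpen_ball, ?_, ⟨v, ?_⟩, ?_⟩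
  · exact (hcl.trans (Metric.closedBall_subset_closedBall (min_le_left _ _))).trans
      (hrV.trans Set.inter_subset_left)
  · exact hcl.trans (Metric.closedBall_subset_closedBall (min_le_right _ _))
  · obtain ⟨x, hx⟩ := hopen _ Metric.isOpen_ball ⟨v, Metric.mem_ball_self hs⟩
    obtain ⟨_, hxI, u, hu, rfl⟩ := mem_closure_iff.1 (interior_subset hx) _ isOpen_interior hx
    exact ⟨ψ u, (hsub hu).2, hxI⟩

lemma exists_add_eq_of_somewhere_dense {Q E : Type*} [TopologicalSpace Q] [PolishSpace Q]
    [AddCommGroup E] [TopologicalSpace E] [IsTopologicalAddGroup E] [T2Space E] {ψ : Q → E}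
    (hψ : Continuous ψ)
    (hopen : ∀ U : Set Q, IsOpen U → U.Nonempty → (interior (closure (ψ '' U))).Nonempty)
    {x y : E} (hx : x ∈ interior (closure (Set.range ψ)))
    (hy : y ∈ interior (closure (Set.range ψ))) :
    ∃ p q, ψ p + ψ q = x + y := by
  let := TopologicalSpace.upgradeIsCompletelyMetrizable Q
  set z := x + y
  have hsub : Continuous fun e : E => z - e := by fun_prop
  let Good : Set Q × Set Q → Prop := fun p => IsOpen p.1 ∧ IsOpen p.2 ∧
    ∃ e ∈ closure (ψ '' p.1), z - e ∈ interior (closure (ψ '' p.2))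
  have hstep : ∀ (k : ℕ) (p : {p // Good p}), ∃ p' : {p // Good p},
      closure p'.1.1 ⊆ p.1.1 ∧ closure p'.1.2 ⊆ p.1.2 ∧
      (∃ v, closure p'.1.1 ⊆ Metric.closedBall v (1 / ((k : ℝ) + 1))) ∧
      (∃ v, closure p'.1.2 ⊆ Metric.closedBall v (1 / ((k : ℝ) + 1))) := by
    rintro k ⟨⟨V, W⟩, hV, hW, e, heV, heW⟩
    obtain ⟨V', hV', hVV', hVb, e', he'W, he'V⟩ := exists_smaller_open hψ hopen hV
      (isOpen_interior.preimage hsub) ⟨e, heW, heV⟩ (Nat.one_div_pos_of_nat (n := k) (α := ℝ))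
    obtain ⟨W', hW', hWW', hWb, e'', he''V, he''W⟩ := exists_smaller_open hψ hopen hW
      ((isOpen_interior (s := closure (ψ '' V'))).preimage hsub)
      ⟨z - e', by simpa using he'V, interior_subset he'W⟩
      (Nat.one_div_pos_of_nat (n := k) (α := ℝ))
    exact ⟨⟨⟨V', W'⟩, hV', hW', z - e'', interior_subset he''V, by simpa using he''W⟩,
      hVV', hWW', hVb, hWb⟩
  choose next h1 h2 h3 h4 using hstep
  let p0 : {p // Good p} := ⟨⟨Set.univ, Set.univ⟩, isOpen_univ, isOpen_univ, x,
    by simpa using interior_subset hx, by simpa [z] using hy⟩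
  let F : ℕ → {p // Good p} := fun k => Nat.rec p0 next k
  choose e he1 he2 using fun k => (F k).2.2.2
  obtain ⟨p, hp⟩ := exists_tendsto_of_shrinking hψ (W := fun k => (F k).1.1)
    (fun k => h1 k (F k)) (fun k => h3 k (F k)) he1
  obtain ⟨q, hq⟩ := exists_tendsto_of_shrinking hψ (W := fun k => (F k).1.2)
    (fun k => h2 k (F k)) (fun k => h4 k (F k)) (fun k => interior_subset (he2 k))
  have := tendsto_nhds_unique hq ((hsub.tendsto _).comp hp)
  exact ⟨p, q, by rw [this]; abel⟩

lemma add_smul_sub_mem_of_midpoint_mem {E : Type*} [AddCommGroup E] [Module ℝ E] {B : Set E}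
    (hB : ∀ x ∈ B, ∀ y ∈ B, (2 : ℝ)⁻¹ • (x + y) ∈ B) {x y : E} (hx : x ∈ B) (hy : y ∈ B) (k : ℕ) :
    x + (2⁻¹ : ℝ) ^ k • (y - x) ∈ B := by
  induction k with
  | zero => simpa using hy
  | succ k ih =>
    convert hB x hx _ ih using 1
    module

lemma sum_smul_add_mem_of_midpoint_mem {E : Type*} [AddCommGroup E] [Module ℝ E] {B : Set E}
    (hB : ∀ x ∈ B, ∀ y ∈ B, (2 : ℝ)⁻¹ • (x + y) ∈ B) {n : ℕ} {x : Fin n → E} (hx : ∀ i, x i ∈ B)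
    {a : E} (ha : a ∈ B) :
    ∑ i, (2⁻¹ : ℝ) ^ (i.val + 1) • x i + (2⁻¹ : ℝ) ^ n • a ∈ B := by
  induction n with
  | zero => simpa using ha
  | succ n ih =>
    convert hB _ (hx 0) _ (ih fun i => hx i.succ) using 1
    rw [Fin.sum_univ_succ]
    simp only [Fin.val_zero, Fin.val_succ, smul_add, Finset.smul_sum, smul_smul, ← pow_succ']
    simp [add_assoc]

lemma continuousOn_of_midconvex_of_le_on_open {E : Type*} [AddCommGroup E] [Module ℝ E]
    [TopologicalSpace E] [IsTopologicalAddGroup E] [ContinuousSMul ℝ E] {D : Set E}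
    (hD : IsOpen D) (hDconv : Convex ℝ D) {f : E → ℝ}
    (hf : ∀ x ∈ D, ∀ y ∈ D, f ((2 : ℝ)⁻¹ • (x + y)) ≤ (f x + f y) / 2)
    {O : Set E} (hO : IsOpen O) (hOne : O.Nonempty) (hOD : O ⊆ D) {M : ℝ}
    (hM : ∀ x ∈ O, f x ≤ M) : ContinuousOn f D := by
  have hmid : ∀ x ∈ D, ∀ y ∈ D, (2 : ℝ)⁻¹ • (x + y) ∈ D := fun x hx y hy => by
    rw [smul_add]
    exact hDconv hx hy (by norm_num) (by norm_num) (by norm_num)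
  have hpow : Filter.Tendsto (fun k : ℕ => (2⁻¹ : ℝ) ^ k) Filter.atTop (𝓝 0) :=
    tendsto_pow_atTop_nhds_zero_of_lt_one (by norm_num) (by norm_num)
  have hlocal : ∀ x ∈ D, ∃ M', ∀ᶠ u in 𝓝 x, u ∈ D ∧ f u ≤ M' := by
    intro x hx
    obtain ⟨o, ho⟩ := hOne
    have hcont : ContinuousAt (fun t : ℝ => (1 - t)⁻¹ • (x - t • o)) 0 := by
      have : (1 : ℝ) - 0 ≠ 0 := by norm_num
      fun_prop (disch := assumption)
    have ht : Filter.Tendsto (fun k : ℕ => (1 - (2⁻¹ : ℝ) ^ k)⁻¹ • (x - (2⁻¹ : ℝ) ^ k • o))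
        Filter.atTop (𝓝 x) := by
      have := hcont.tendsto.comp hpow
      simpa [Function.comp_def] using this
    obtain ⟨k, hkD, hk1⟩ := ((ht.eventually (hD.mem_nhds hx)).and
      (hpow.eventually (gt_mem_nhds one_pos))).exists
    set t : ℝ := (2⁻¹ : ℝ) ^ k with ht
    have ht0 : t ≠ 0 := by positivity
    have ht1 : 1 - t ≠ 0 := by linarith
    set y := (1 - t)⁻¹ • (x - t • o) with hy
    have hyx : y + t⁻¹ • (x - y) = o := by
      have : x = (1 - t) • y + t • o := by
        rw [hy, smul_inv_smul₀ ht1]; abel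
      have h2 : x - y = t • (o - y) := by
        rw [this]; module
      rw [h2, inv_smul_smul₀ ht0]; abel
    have hO' : ∀ᶠ u in 𝓝 x, y + t⁻¹ • (u - y) ∈ O := by
      have : Continuous fun u : E => y + t⁻¹ • (u - y) := by fun_prop
      exact this.continuousAt.eventually (hO.mem_nhds (by simpa only [hyx] using ho))
    refine ⟨max (f y) M, ?_⟩
    filter_upwards [hO'] with u hu
    have hB : ∀ p ∈ {p | p ∈ D ∧ f p ≤ max (f y) M}, ∀ q ∈ {p | p ∈ D ∧ f p ≤ max (f y) M},
        (2 : ℝ)⁻¹ • (p + q) ∈ {p | p ∈ D ∧ f p ≤ max (f y) M} := fun p hp q hq =>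
      ⟨hmid p hp.1 q hq.1, (hf p hp.1 q hq.1).trans (by linarith [hp.2, hq.2])⟩
    have := add_smul_sub_mem_of_midpoint_mem hB (x := y) ⟨hkD, le_max_left _ _⟩
      ⟨hOD hu, (hM _ hu).trans (le_max_right _ _)⟩ k
    rwa [← ht, add_sub_cancel_left, smul_inv_smul₀ ht0, add_sub_cancel] at this
  intro x hx
  refine ContinuousAt.continuousWithinAt ?_
  obtain ⟨M', hM'⟩ := hlocal x hx
  have hstep : ∀ w ∈ D, ∀ k : ℕ, x + (2⁻¹ : ℝ) ^ k • (w - x) ∈ D ∧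
      f (x + (2⁻¹ : ℝ) ^ k • (w - x)) ≤ f x + (2⁻¹ : ℝ) ^ k * (f w - f x) := by
    intro w hw k
    refine ⟨add_smul_sub_mem_of_midpoint_mem hmid hx hw k, ?_⟩
    induction k with
    | zero => simp
    | succ k ih =>
      have h1 : x + (2⁻¹ : ℝ) ^ (k + 1) • (w - x) =
          (2 : ℝ)⁻¹ • (x + (x + (2⁻¹ : ℝ) ^ k • (w - x))) := by module
      rw [h1]
      refine (hf x hx _ (add_smul_sub_mem_of_midpoint_mem hmid hx hw k)).trans ?_
      rw [pow_succ]
      linarith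
  rw [ContinuousAt, Metric.tendsto_nhds]
  intro ε hε
  have hlim : Filter.Tendsto (fun k : ℕ => (2⁻¹ : ℝ) ^ k * (M' - f x)) Filter.atTop (𝓝 0) := by
    simpa using hpow.mul_const (M' - f x)
  obtain ⟨k, hk⟩ := (hlim.eventually (gt_mem_nhds hε)).exists
  have ht0 : (2⁻¹ : ℝ) ^ k ≠ 0 := by positivity
  have hright : ∀ᶠ u in 𝓝 x, x + ((2⁻¹ : ℝ) ^ k)⁻¹ • (u - x) ∈ {u | u ∈ D ∧ f u ≤ M'} := by
    have : Continuous fun u : E => x + ((2⁻¹ : ℝ) ^ k)⁻¹ • (u - x) := by fun_prop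
    exact this.continuousAt.eventually (by simpa using hM')
  have hleft : ∀ᶠ u in 𝓝 x, x + ((2⁻¹ : ℝ) ^ k)⁻¹ • (x - u) ∈ {u | u ∈ D ∧ f u ≤ M'} := by
    have : Continuous fun u : E => x + ((2⁻¹ : ℝ) ^ k)⁻¹ • (x - u) := by fun_prop
    exact this.continuousAt.eventually (by simpa using hM')
  filter_upwards [hright, hleft] with u hu hu'
  obtain ⟨hr, hr'⟩ := hstep _ hu.1 k
  obtain ⟨hl, hl'⟩ := hstep _ hu'.1 k
  rw [add_sub_cancel_left, smul_inv_smul₀ ht0] at hr hr' hl hl'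
  have hmul : ∀ s ≤ M', (2⁻¹ : ℝ) ^ k * (s - f x) < ε := fun s hs =>
    lt_of_le_of_lt (by gcongr) hk
  have h1 := hmul _ hu.2
  have h2 := hmul _ hu'.2
  have h3 := hf _ hr _ hl
  rw [show (2 : ℝ)⁻¹ • (x + (u - x) + (x + (x - u))) = x by module] at h3
  rw [add_sub_cancel] at hr' h3
  rw [Real.dist_eq, abs_lt]
  constructor <;> linarith

lemma exists_isClosed_forall_not_isMeagre_image {P X : Type*} [TopologicalSpace P]
    [SecondCountableTopology P] [TopologicalSpace X] {φ : P → X}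
    (h : ¬ IsMeagre (Set.range φ)) :
    ∃ F : Set P, IsClosed F ∧ F.Nonempty ∧
      ∀ U, IsOpen U → (U ∩ F).Nonempty → ¬ IsMeagre (φ '' (U ∩ F)) := by
  let 𝒲 : Set (Set P) := {b ∈ TopologicalSpace.countableBasis P | IsMeagre (φ '' b)}
  have hcount : Countable 𝒲 :=
    ((TopologicalSpace.countable_countableBasis P).mono (Set.sep_subset _ _)).to_subtype
  have hW : IsMeagre (φ '' ⋃₀ 𝒲) := by
    rw [Set.sUnion_eq_iUnion, Set.image_iUnion]
    exact isMeagre_iUnion fun b => b.2.2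
  refine ⟨(⋃₀ 𝒲)ᶜ, (isOpen_sUnion fun b hb =>
    TopologicalSpace.isOpen_of_mem_countableBasis hb.1).isClosed_compl, ?_, ?_⟩
  · by_contra hne
    rw [Set.not_nonempty_iff_eq_empty, Set.compl_empty_iff] at hne
    rw [hne, Set.image_univ] at hW
    exact h hW
  · rintro U hU ⟨x, hxU, hxF⟩ hm
    obtain ⟨b, hb, hxb, hbU⟩ :=
      (TopologicalSpace.isBasis_countableBasis P).exists_subset_of_mem_open hxU hU
    refine hxF ⟨b, ⟨hb, (hm.union hW).mono ?_⟩, hxb⟩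
    rw [← Set.image_union]
    refine Set.image_mono fun y hy => ?_
    by_cases hyW : y ∈ ⋃₀ 𝒲
    · exact Or.inr hyW
    · exact Or.inl ⟨hbU hy, hyW⟩

lemma NowhereFlat.exists_isPreconnected_subset {n : ℕ} {S : Set (Fin n → ℝ)}
    [LocallyConnectedSpace S] (hS : NowhereFlat S) {G : Set S} (hG : IsOpen G)
    (hne : G.Nonempty) :
    ∃ C ⊆ Subtype.val '' G, IsPreconnected C ∧ Bornology.IsBounded C ∧ affineSpan ℝ C = ⊤ := by
  obtain ⟨x, hx⟩ := hne
  let G' : Set S := G ∩ Subtype.val ⁻¹' Metric.ball x.1 1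
  have hG' : IsOpen G' := hG.inter (Metric.isOpen_ball.preimage continuous_subtype_val)
  have hx' : x ∈ G' := ⟨hx, Metric.mem_ball_self one_pos⟩
  have hsub : connectedComponentIn G' x ⊆ G' := connectedComponentIn_subset _ _
  refine ⟨Subtype.val '' connectedComponentIn G' x,
    Set.image_mono (hsub.trans Set.inter_subset_left),
    isPreconnected_connectedComponentIn.image _ continuous_subtype_val.continuousOn,
    Metric.isBounded_ball.subset (Set.image_subset_iff.2 (hsub.trans Set.inter_subset_right)), ?_⟩
  obtain ⟨V, hV, hVC⟩ := isOpen_induced_iff.1 (hG'.connectedComponentIn (x := x))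
  rw [← hVC, Subtype.image_preimage_coe, Set.inter_comm]
  refine hS V hV ⟨x, ?_, x.2⟩
  have : x ∈ Subtype.val ⁻¹' V := hVC ▸ mem_connectedComponentIn hx'
  exact this

lemma affineSpan_image_smul_eq_top {E : Type*} [AddCommGroup E] [Module ℝ E] {C : Set E}
    (hC : affineSpan ℝ C = ⊤) {w : ℝ} (hw : w ≠ 0) :
    affineSpan ℝ ((fun x => w • x) '' C) = ⊤ :=
  AffineMap.span_eq_top_of_surjective (w • LinearMap.id (R := ℝ) (M := E)).toAffineMap
    (fun y => ⟨w⁻¹ • y, by simp [smul_smul, hw]⟩) hC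

lemma NowhereFlat.interior_closure_sum_image_nonempty {n : ℕ} {S : Set (Fin n → ℝ)}
    [LocallyConnectedSpace S] (hS : NowhereFlat S) {P : Type*} [TopologicalSpace P]
    {φ : P → S} (hφ : ∀ U : Set P, IsOpen U → U.Nonempty → ¬ IsMeagre (φ '' U))
    {w : Fin n → ℝ} (hw : ∀ i, w i ≠ 0) {U : Set (Fin n → P)} (hU : IsOpen U)
    (hne : U.Nonempty) :
    (interior (closure ((fun p : Fin n → P => ∑ i, w i • (φ (p i)).1) '' U))).Nonempty := by
  obtain ⟨p, hp⟩ := hne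
  obtain ⟨V, hV, hVU⟩ := isOpen_pi_iff'.1 hU p hp
  have hsd : ∀ i, (interior (closure (φ '' V i))).Nonempty := fun i => by
    by_contra h
    exact hφ (V i) (hV i).1 ⟨p i, (hV i).2⟩
      (IsNowhereDense.isMeagre (Set.not_nonempty_iff_eq_empty.1 h))
  choose C hCsub hCconn hCb hCspan using fun i =>
    hS.exists_isPreconnected_subset isOpen_interior (hsd i)
  have hCcl : ∀ i, C i ⊆ closure (Subtype.val '' (φ '' V i)) := fun i =>
    (hCsub i).trans ((Set.image_mono interior_subset).trans
      (image_closure_subset_closure_image continuous_subtype_val))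
  have key := interior_closure_sum_nonempty (C := fun i => (fun x => w i • x) '' C i)
    (fun i => (hCconn i).image _ (by fun_prop)) (fun i => (hCb i).smul₀ (w i))
    (fun i => affineSpan_image_smul_eq_top (hCspan i) (hw i))
  refine key.mono (interior_mono (closure_minimal ?_ isClosed_closure))
  rintro _ ⟨c, hc, rfl⟩
  choose c' hc' hcc using fun i => hc i (Set.mem_univ i)
  have hc'' : c' ∈ closure (Set.univ.pi fun i => Subtype.val '' (φ '' V i)) := by
    rw [closure_pi_set]
    exact fun i _ => hCcl i (hc' i)
  have hcont : Continuous fun c : Fin n → Fin n → ℝ => ∑ i, w i • c i := by fun_prop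
  have hmem := image_closure_subset_closure_image hcont (Set.mem_image_of_mem _ hc'')
  simp only [hcc] at hmem
  refine closure_mono ?_ hmem
  rintro _ ⟨u, hu, rfl⟩
  choose v hv hvu using fun i => hu i (Set.mem_univ i)
  choose q hq hqv using hv
  refine ⟨q, hVU fun i _ => hq i, ?_⟩
  simp only [hqv, hvu]

theorem midconvex_continuous_of_bddAbove_on_nonmeager_analytic_subset
    {n : ℕ} (hn : 0 < n) (D : Set (Fin n → ℝ))
    (hne : D.Nonempty) (hD : IsOpen D) (hDconv : Convex ℝ D)
    (f : (Fin n → ℝ) → ℝ)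
    (hf : ∀ x ∈ D, ∀ y ∈ D, f ((2 : ℝ)⁻¹ • (x + y)) ≤ (f x + f y) / 2)
    (S : Set (Fin n → ℝ)) (hSD : S ⊆ D)
    (hloc : LocallyConnectedSpace ↥S) (hnf : NowhereFlat S)
    (A : Set (Fin n → ℝ)) (hAS : A ⊆ S)
    (hanal : MeasureTheory.AnalyticSet A)
    (hA : ¬ IsMeagre ((Subtype.val ⁻¹' A) : Set ↥S))
    (hbdd : BddAbove (f '' A)) :
    ContinuousOn f D := by
  obtain ⟨M, hM⟩ := hbdd
  obtain ⟨a, ha⟩ := nonempty_of_not_isMeagre hA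
  rw [MeasureTheory.AnalyticSet] at hanal
  obtain rfl | ⟨φ, hφ, rfl⟩ := hanal
  · exact ha.elim
  let φS : (ℕ → ℕ) → S := fun p => ⟨φ p, hAS ⟨p, rfl⟩⟩
  have hrange : Subtype.val ⁻¹' Set.range φ = Set.range φS := by
    ext s
    simp [φS, Subtype.ext_iff]
  rw [hrange] at hA
  obtain ⟨F, hF, ⟨p₀, hp₀⟩, hFm⟩ := exists_isClosed_forall_not_isMeagre_image hA
  have : PolishSpace F := hF.polishSpace
  let B : Set (Fin n → ℝ) := {x | x ∈ D ∧ f x ≤ M}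
  have hB : ∀ x ∈ B, ∀ y ∈ B, (2 : ℝ)⁻¹ • (x + y) ∈ B := fun x hx y hy => by
    refine ⟨?_, (hf x hx.1 y hy.1).trans (by linarith [hx.2, hy.2])⟩
    rw [smul_add]
    exact hDconv hx.1 hy.1 (by norm_num) (by norm_num) (by norm_num)
  have hφB : ∀ p, φ p ∈ B := fun p => ⟨hSD (hAS ⟨p, rfl⟩), hM ⟨φ p, ⟨p, rfl⟩, rfl⟩⟩
  let ψ : (Fin n → F) → Fin n → ℝ := fun p =>
    ∑ i, (2⁻¹ : ℝ) ^ (i.val + 1) • ((φS (p i)).1 : Fin n → ℝ)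
  set κ : Fin n → ℝ := (2⁻¹ : ℝ) ^ n • φ p₀
  have hψB : ∀ p, ψ p + κ ∈ B := fun p =>
    sum_smul_add_mem_of_midpoint_mem hB (fun i => hφB (p i)) (hφB p₀)
  have hψ : Continuous ψ := by
    change Continuous fun p : Fin n → F => ∑ i, (2⁻¹ : ℝ) ^ (i.val + 1) • φ (p i)
    fun_prop
  have hFm' : ∀ U : Set F, IsOpen U → U.Nonempty →
      ¬ IsMeagre ((fun p : F => φS p) '' U) := by
    rintro U hU ⟨p, hp⟩
    obtain ⟨V, hV, rfl⟩ := isOpen_induced_iff.1 hU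
    have := hFm V hV ⟨p, hp, p.2⟩
    rwa [Set.inter_comm, ← Subtype.image_preimage_coe, Set.image_image] at this
  have hopen : ∀ U : Set (Fin n → F), IsOpen U → U.Nonempty →
      (interior (closure (ψ '' U))).Nonempty := fun U hU hUne =>
    hnf.interior_closure_sum_image_nonempty hFm' (fun i => by positivity) hU hUne
  set I := interior (closure (Set.range ψ))
  have hIB : ∀ x ∈ I, x + κ ∈ B := by
    intro x hx
    obtain ⟨p, q, hpq⟩ := exists_add_eq_of_somewhere_dense hψ hopen hx hx
    convert hB _ (hψB p) _ (hψB q) using 1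
    rw [add_add_add_comm, hpq]
    module
  have hIne : I.Nonempty := by
    have := hopen Set.univ isOpen_univ ⟨fun _ => ⟨p₀, hp₀⟩, trivial⟩
    rwa [Set.image_univ] at this
  have hOB : ∀ x ∈ (fun x => x - κ) ⁻¹' I, x ∈ B := fun x hx => by
    simpa using hIB _ hx
  refine continuousOn_of_midconvex_of_le_on_open hD hDconv hf
    (O := (fun x => x - κ) ⁻¹' I) (isOpen_interior.preimage (by fun_prop)) ?_
    (fun x hx => (hOB x hx).1) (fun x hx => (hOB x hx).2)
  obtain ⟨x, hx⟩ := hIne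
  exact ⟨x + κ, by simpa using hx⟩
end

section
/- Let n ≥ 2, let a < b be real numbers, and let φ : ℝ → ℝⁿ be continuously differentiable on [a, b] such that the affine span of φ([a, b]) equals all of ℝⁿ (i.e., the curve does not lie entirely in an (n−1)-dimensional affine hyperplane). Let Z ⊆ [a, b] be a measurable set such that the Lebesgue measure of Z ∩ (c, d) is positive for every nontrivial open subinterval (c, d) ⊆ [a, b]. Then for every open convex set D ⊆ ℝⁿ containing φ(Z) and every mid-convex function f : D → ℝ that is bounded above on φ(Z), the function f is continuous on D. -/
open MeasureTheory Set

open scoped Topology Pointwise NNReal ENNReal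

/-- A midpoint convex function satisfies Jensen's inequality for the dyadic weights
`2⁻ᵏ` and `1 - 2⁻ᵏ`. -/
theorem midconvex_dyadic_le {E : Type*} [AddCommGroup E] [Module ℝ E] {D : Set E} {f : E → ℝ}
    (hD : Convex ℝ D)
    (hf : ∀ x ∈ D, ∀ y ∈ D, f ((2 : ℝ)⁻¹ • (x + y)) ≤ (f x + f y) / 2)
    {x y : E} (hx : x ∈ D) (hy : y ∈ D) (k : ℕ) :
    f ((2⁻¹ : ℝ) ^ k • x + (1 - (2⁻¹ : ℝ) ^ k) • y) ≤
      (2⁻¹ : ℝ) ^ k * f x + (1 - (2⁻¹ : ℝ) ^ k) * f y := by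
  induction k with
  | zero => simp
  | succ k ih =>
    have hmem : (2⁻¹ : ℝ) ^ k • x + (1 - (2⁻¹ : ℝ) ^ k) • y ∈ D :=
      hD hx hy (by positivity) (sub_nonneg.2 (pow_le_one₀ (by norm_num) (by norm_num))) (by ring)
    have h := hf _ hmem _ hy
    have heq : (2 : ℝ)⁻¹ • ((2⁻¹ : ℝ) ^ k • x + (1 - (2⁻¹ : ℝ) ^ k) • y + y) =
        (2⁻¹ : ℝ) ^ (k + 1) • x + (1 - (2⁻¹ : ℝ) ^ (k + 1)) • y := by
      module
    rw [heq] at h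
    rw [pow_succ] at h ⊢
    linarith

/-- A midpoint convex function which is bounded above near a point is continuous there. -/
theorem midconvex_continuousAt_of_eventually_le {E : Type*} [NormedAddCommGroup E]
    [NormedSpace ℝ E] {D : Set E} {f : E → ℝ} (hDo : IsOpen D) (hD : Convex ℝ D)
    (hf : ∀ x ∈ D, ∀ y ∈ D, f ((2 : ℝ)⁻¹ • (x + y)) ≤ (f x + f y) / 2)
    {y : E} (hy : y ∈ D) {M : ℝ} (hM : ∀ᶠ x in 𝓝 y, f x ≤ M) : ContinuousAt f y := by
  obtain ⟨r, hr, hball⟩ := Metric.eventually_nhds_iff_ball.1 (hM.and (hDo.mem_nhds hy))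
  have upper : ∀ k : ℕ, ∀ x ∈ Metric.ball y ((2⁻¹ : ℝ) ^ k * r),
      f x - f y ≤ (2⁻¹ : ℝ) ^ k * (M - f y) ∧ x ∈ D := by
    intro k x hx
    have hk : (0 : ℝ) < 2⁻¹ ^ k := by positivity
    have hu : y + ((2⁻¹ : ℝ) ^ k)⁻¹ • (x - y) ∈ Metric.ball y r := by
      rw [mem_ball_iff_norm] at hx ⊢
      rw [add_sub_cancel_left, norm_smul, norm_inv, Real.norm_of_nonneg hk.le,
        inv_mul_lt_iff₀ hk]
      exact hx
    have hxu : (2⁻¹ : ℝ) ^ k • (y + ((2⁻¹ : ℝ) ^ k)⁻¹ • (x - y)) + (1 - (2⁻¹ : ℝ) ^ k) • y = x := by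
      rw [smul_add, smul_inv_smul₀ hk.ne']
      module
    have h := midconvex_dyadic_le hD hf (hball _ hu).2 hy k
    rw [hxu] at h
    refine ⟨by nlinarith [(hball _ hu).1], ?_⟩
    rw [← hxu]
    exact hD (hball _ hu).2 hy hk.le (sub_nonneg.2 (pow_le_one₀ (by norm_num) (by norm_num)))
      (by ring)
  have hlim : Filter.Tendsto (fun k : ℕ => (2⁻¹ : ℝ) ^ k * (M - f y)) Filter.atTop (𝓝 0) := by
    simpa using (tendsto_pow_atTop_nhds_zero_of_lt_one (r := (2⁻¹ : ℝ)) (by norm_num)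
      (by norm_num)).mul_const (M - f y)
  rw [Metric.continuousAt_iff]
  intro ε hε
  obtain ⟨k, hk⟩ := (hlim.eventually (gt_mem_nhds hε)).exists
  refine ⟨(2⁻¹ : ℝ) ^ k * r, by positivity, fun x hx => ?_⟩
  have hx' : y + y - x ∈ Metric.ball y ((2⁻¹ : ℝ) ^ k * r) := by
    rw [mem_ball_iff_norm, show y + y - x - y = -(x - y) by abel, norm_neg]
    rwa [dist_eq_norm] at hx
  obtain ⟨h1, hxD⟩ := upper k x hx
  obtain ⟨h2, hxD'⟩ := upper k _ hx'
  have h3 := hf x hxD _ hxD'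
  rw [show (2 : ℝ)⁻¹ • (x + (y + y - x)) = y by module] at h3
  rw [Real.dist_eq, abs_lt]
  constructor <;> linarith

/-- **Bernstein–Doetsch theorem**: a midpoint convex function on an open convex set which is
bounded above near one point is continuous. -/
theorem midconvex_continuousOn_of_eventually_le {E : Type*} [NormedAddCommGroup E]
    [NormedSpace ℝ E] {D : Set E} {f : E → ℝ} (hDo : IsOpen D) (hD : Convex ℝ D)
    (hf : ∀ x ∈ D, ∀ y ∈ D, f ((2 : ℝ)⁻¹ • (x + y)) ≤ (f x + f y) / 2)
    {p : E} {M : ℝ} (hM : ∀ᶠ x in 𝓝 p, x ∈ D ∧ f x ≤ M) : ContinuousOn f D := by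
  intro y hy
  have hlim : Filter.Tendsto (fun k : ℕ => (2⁻¹ : ℝ) ^ k) Filter.atTop (𝓝 0) :=
    tendsto_pow_atTop_nhds_zero_of_lt_one (by norm_num) (by norm_num)
  have hz : ∀ᶠ t : ℝ in 𝓝 0, y + (t / (1 - t)) • (y - p) ∈ D := by
    have hc : ContinuousAt (fun t : ℝ => y + (t / (1 - t)) • (y - p)) 0 := by
      have : ContinuousAt (fun t : ℝ => t / (1 - t)) 0 :=
        continuousAt_id.div (continuousAt_const.sub continuousAt_id) (by simp)
      exact continuousAt_const.add (this.smul continuousAt_const)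
    exact hc.eventually_mem (hDo.mem_nhds (by simpa using hy))
  obtain ⟨k, hkD, hk1⟩ :=
    ((hlim.eventually hz).and (hlim.eventually (gt_mem_nhds one_pos))).exists
  have hk0 : (0 : ℝ) < 2⁻¹ ^ k := by positivity
  set t : ℝ := 2⁻¹ ^ k with ht
  set z := y + (t / (1 - t)) • (y - p) with hzdef
  have hyz : t • p + (1 - t) • z = y := by
    have h1 : (1 - t) * (t / (1 - t)) = t := mul_div_cancel₀ _ (by linarith)
    rw [hzdef, smul_add, smul_smul, h1]
    module
  have hcont : ContinuousAt (fun x => t⁻¹ • (x - (1 - t) • z)) y := by fun_prop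
  have hpy : t⁻¹ • (y - (1 - t) • z) = p := by
    rw [← hyz, add_sub_cancel_right, inv_smul_smul₀ hk0.ne']
  refine (midconvex_continuousAt_of_eventually_le hDo hD hf hy
    (M := t * M + (1 - t) * f z) ?_).continuousWithinAt
  have hM' := hcont.eventually (p := fun x => x ∈ D ∧ f x ≤ M) (by simpa only [hpy] using hM)
  filter_upwards [hM'] with x hx
  have h := midconvex_dyadic_le hD hf hx.1 hkD k
  rw [← ht, smul_inv_smul₀ hk0.ne', sub_add_cancel] at h
  nlinarith [hx.2]

/-- **Steinhaus theorem** for sums: if `A` has positive measure, `A + A` has an interior point. -/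
theorem exists_add_self_mem_nhds {E : Type*} [NormedAddCommGroup E] [NormedSpace ℝ E]
    [FiniteDimensional ℝ E] [MeasurableSpace E] [BorelSpace E] (μ : Measure E)
    [μ.IsAddHaarMeasure] {A : Set E} (hA : MeasurableSet A) (hpos : 0 < μ A) :
    ∃ c, A + A ∈ 𝓝 c := by
  have : ProperSpace E := FiniteDimensional.proper_real E
  have : SecondCountableTopology E := secondCountable_of_proper
  let T : Set (E × E) := {q | q.1 ∈ A ∧ q.2 - q.1 ∈ A}
  have hT : MeasurableSet T :=
    (measurable_fst hA).inter ((measurable_snd.sub measurable_fst) hA)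
  have hTpos : μ.prod μ T ≠ 0 := by
    rw [← (measurePreserving_prod_add μ μ).measure_preimage hT.nullMeasurableSet,
      show (fun z : E × E => (z.1, z.1 + z.2)) ⁻¹' T = A ×ˢ A by ext; simp [T],
      Measure.prod_prod]
    exact mul_ne_zero hpos.ne' hpos.ne'
  obtain ⟨c, hc⟩ : ∃ c, 0 < μ ((fun x => (x, c)) ⁻¹' T) := by
    by_contra! h
    rw [Measure.prod_apply_symm hT] at hTpos
    exact hTpos (by simp only [fun c => nonpos_iff_eq_zero.1 (h c), lintegral_zero])
  refine ⟨c, ?_⟩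
  have hB := Measure.sub_mem_nhds_zero_of_addHaar_pos μ _ (measurable_prodMk_right hT) hc
  have hcont : Filter.Tendsto (fun p : E => p - c) (𝓝 c) (𝓝 0) := by
    simpa using (continuous_id.sub continuous_const).tendsto (f := fun p : E => p - c) c
  filter_upwards [hcont hB] with p hp
  obtain ⟨x, hx, y, hy, hxy⟩ := hp
  refine ⟨x, hx.1, c - y, hy.2, ?_⟩
  have : x - y = p - c := hxy
  change x + (c - y) = p
  rw [show x + (c - y) = (x - y) + c by abel, this, sub_add_cancel]

/-- If the image of a `C¹` curve affinely spans the space, then its velocities span it linearly. -/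
theorem span_deriv_eq_top_of_affineSpan_eq_top {E : Type*} [NormedAddCommGroup E]
    [NormedSpace ℝ E] [FiniteDimensional ℝ E] {a b : ℝ} {φ : ℝ → E}
    (hc : ContinuousOn φ (Icc a b)) (hd : ∀ t ∈ Ioo a b, DifferentiableAt ℝ φ t)
    (hspan : affineSpan ℝ (φ '' Icc a b) = ⊤) :
    Submodule.span ℝ (deriv φ '' Ioo a b) = ⊤ := by
  by_contra hne
  obtain ⟨ℓ, hℓ, hle⟩ := Submodule.exists_le_ker_of_lt_top _ (lt_top_iff_ne_top.2 hne)
  let L : E →L[ℝ] ℝ := LinearMap.toContinuousLinearMap ℓ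
  have hderiv : ∀ t ∈ Ioo a b, HasDerivAt (fun s => L (φ s)) 0 t := by
    intro t ht
    have h := L.hasFDerivAt.comp_hasDerivAt t (hd t ht).hasDerivAt
    have h0 : L (deriv φ t) = 0 := hle (Submodule.subset_span ⟨t, ht, rfl⟩)
    rwa [h0] at h
  have hconst : ∀ s ∈ Icc a b, ∀ t ∈ Icc a b, s < t → L (φ s) = L (φ t) := by
    intro s hs t ht hst
    obtain ⟨u, -, hu⟩ := exists_hasDerivAt_eq_slope (fun s => L (φ s)) (fun _ => 0) hst
      (L.continuous.comp_continuousOn (hc.mono (Icc_subset_Icc hs.1 ht.2)))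
      (fun x hx => hderiv x ⟨hs.1.trans_lt hx.1, hx.2.trans_le ht.2⟩)
    have hst' : t - s ≠ 0 := (sub_pos.2 hst).ne'
    field_simp at hu
    linarith
  have hv := AffineSubspace.vectorSpan_eq_top_of_affineSpan_eq_top ℝ E E hspan
  apply hℓ
  rw [← LinearMap.ker_eq_top, ← top_le_iff, ← hv, vectorSpan_def, Submodule.span_le]
  rintro _ ⟨_, ⟨s, hs, rfl⟩, _, ⟨t, ht, rfl⟩, rfl⟩
  have : L (φ s) = L (φ t) := by
    rcases lt_trichotomy s t with h | h | h
    · exact hconst s hs t ht h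
    · rw [h]
    · exact (hconst t ht s hs h).symm
  simpa [sub_eq_zero, L] using this

/-- A map with invertible strict derivative at `x` sends a measurable set which has positive
measure near `x` onto a set containing a compact set of positive measure. -/
theorem exists_isCompact_subset_image_measure_pos {E : Type*} [NormedAddCommGroup E]
    [NormedSpace ℝ E] [FiniteDimensional ℝ E] [MeasurableSpace E] [BorelSpace E]
    (μ : Measure E) [μ.IsAddHaarMeasure] {F : E → E} {F' : E →L[ℝ] E} {x : E}
    (hF : HasStrictFDerivAt F F' x) (hdet : F'.det ≠ 0) {P : Set E}
    (hP : ∀ U ∈ 𝓝 x, ∃ Q ⊆ P ∩ U, MeasurableSet Q ∧ 0 < μ Q) :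
    ∃ K ⊆ F '' P, IsCompact K ∧ 0 < μ K := by
  obtain ⟨m, hm0, hm⟩ : ∃ m : ℝ≥0, 0 < m ∧ (m : ℝ≥0∞) < ENNReal.ofReal |F'.det| := by
    obtain ⟨m, h0, h1⟩ := ENNReal.lt_iff_exists_nnreal_btwn.1
      (ENNReal.ofReal_pos.2 (abs_pos.2 hdet))
    exact ⟨m, by exact_mod_cast h0, h1⟩
  obtain ⟨δ, hδ, hδ0⟩ :=
    ((mul_le_addHaar_image_of_lt_det μ F' hm).and self_mem_nhdsWithin).exists
  obtain ⟨U, hU, hUF⟩ := hF.approximates_deriv_on_nhds (Or.inr hδ0)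
  obtain ⟨Q, hQ, hQm, hQpos⟩ := hP U hU
  obtain ⟨K, hKQ, hK, hKpos⟩ := hQm.exists_lt_isCompact hQpos
  have hKU : ApproximatesLinearOn F F' K δ := hUF.mono_set fun z hz => (hQ (hKQ hz)).2
  refine ⟨F '' K, image_mono fun z hz => (hQ (hKQ hz)).1, hK.image_of_continuousOn
    hKU.continuousOn, lt_of_lt_of_le ?_ (hδ K F hKU)⟩
  exact ENNReal.mul_pos (by exact_mod_cast hm0.ne') hKpos.ne'

/-- A set closed under midpoints is closed under convex combinations with weights
`1/2, 1/4, …, 2⁻ⁿ, 2⁻ⁿ`. -/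
theorem sum_dyadic_mem_of_midpoint_mem {E : Type*} [AddCommGroup E] [Module ℝ E] {S : Set E}
    (hS : ∀ x ∈ S, ∀ y ∈ S, (2 : ℝ)⁻¹ • (x + y) ∈ S) {n : ℕ} (x : Fin n → E)
    (hx : ∀ i, x i ∈ S) {z : E} (hz : z ∈ S) :
    ∑ i : Fin n, (2⁻¹ : ℝ) ^ ((i : ℕ) + 1) • x i + (2⁻¹ : ℝ) ^ n • z ∈ S := by
  induction n with
  | zero => simpa using hz
  | succ n ih =>
    have h := hS _ (hx 0) _ (ih (fun i => x i.succ) fun i => hx _)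
    convert h using 1
    rw [Fin.sum_univ_succ, smul_add, smul_add, Finset.smul_sum, smul_smul, ← pow_succ', add_assoc]
    simp [smul_smul, pow_succ']

/-- Positive weighted sums of the values of a curve along independent velocities define a local
diffeomorphism of `ℝⁿ`. -/
theorem hasStrictFDerivAt_sum_smul_curve {n : ℕ} {φ : ℝ → Fin n → ℝ} {t : Fin n → ℝ}
    {v : Fin n → Fin n → ℝ} (hφ : ∀ i, HasStrictDerivAt φ (v i) (t i))
    (hv : LinearIndependent ℝ v) {w : Fin n → ℝ} (hw : ∀ i, w i ≠ 0) (z : Fin n → ℝ) :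
    ∃ F' : (Fin n → ℝ) →L[ℝ] (Fin n → ℝ), F'.det ≠ 0 ∧
      HasStrictFDerivAt (fun s : Fin n → ℝ => ∑ i, w i • φ (s i) + z) F' t := by
  let F' : (Fin n → ℝ) →L[ℝ] (Fin n → ℝ) :=
    ∑ i, w i • ((ContinuousLinearMap.toSpanSingleton ℝ (v i)).comp
      (ContinuousLinearMap.proj (R := ℝ) (φ := fun _ : Fin n => ℝ) i))
  have hF' : HasStrictFDerivAt (fun s : Fin n → ℝ => ∑ i, w i • φ (s i) + z) F' t := by
    refine (HasStrictFDerivAt.fun_sum fun i _ => ?_).add_const z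
    exact (HasStrictFDerivAt.comp t (hφ i).hasStrictFDerivAt
      (ContinuousLinearMap.proj (R := ℝ) (φ := fun _ : Fin n => ℝ) i).hasStrictFDerivAt).const_smul
      (w i)
  refine ⟨F', ?_, hF'⟩
  have hinj : LinearMap.ker (F' : (Fin n → ℝ) →ₗ[ℝ] (Fin n → ℝ)) = ⊥ := by
    rw [LinearMap.ker_eq_bot']
    intro x hx
    have hsum : ∑ i, (w i * x i) • v i = 0 := by
      simpa [F', mul_smul] using hx
    funext i
    simpa [hw i] using Fintype.linearIndependent_iff.1 hv _ hsum i
  intro hdet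
  exact (LinearMap.bot_lt_ker_of_det_eq_zero hdet).ne' hinj

theorem ger_curve_density_version
    {n : ℕ} (hn : 2 ≤ n) (a b : ℝ) (hab : a < b)
    (φ : ℝ → (Fin n → ℝ)) (hφ : ContDiffOn ℝ 1 φ (Icc a b))
    (hspan : affineSpan ℝ (φ '' Icc a b) = ⊤)
    (Z : Set ℝ) (hZab : Z ⊆ Icc a b) (hZmeas : MeasurableSet Z)
    (hZ : ∀ c d : ℝ, a ≤ c → c < d → d ≤ b → 0 < volume (Z ∩ Ioo c d))
    (D : Set (Fin n → ℝ)) (hD : IsOpen D) (hDconv : Convex ℝ D) (hZD : φ '' Z ⊆ D)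
    (f : (Fin n → ℝ) → ℝ)
    (hf : ∀ x ∈ D, ∀ y ∈ D, f ((2 : ℝ)⁻¹ • (x + y)) ≤ (f x + f y) / 2)
    (hbdd : BddAbove (f '' (φ '' Z))) :
    ContinuousOn f D := by
  obtain ⟨M, hM⟩ := hbdd
  have hφat : ∀ t ∈ Ioo a b, ContDiffAt ℝ 1 φ t := fun t ht =>
    hφ.contDiffAt (Icc_mem_nhds ht.1 ht.2)
  have hspan' := span_deriv_eq_top_of_affineSpan_eq_top hφ.continuousOn
    (fun t ht => (hφat t ht).differentiableAt one_ne_zero) hspan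
  obtain ⟨v, hvmem, hv⟩ : ∃ v : Fin n → Fin n → ℝ,
      (∀ i, v i ∈ deriv φ '' Ioo a b) ∧ LinearIndependent ℝ v := by
    obtain ⟨v, h1, -, h2⟩ := Submodule.exists_fun_fin_finrank_span_eq ℝ (deriv φ '' Ioo a b)
    have hn' : n = Module.finrank ℝ (Submodule.span ℝ (deriv φ '' Ioo a b)) := by
      rw [hspan', finrank_top, Module.finrank_fin_fun]
    exact ⟨v ∘ Fin.cast hn', fun i => h1 _, h2.comp _ (Fin.cast_injective hn')⟩
  choose t ht htv using hvmem
  obtain ⟨z, hz, -⟩ : (Z ∩ Ioo a b).Nonempty :=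
    nonempty_of_measure_ne_zero (hZ a b le_rfl hab le_rfl).ne'
  obtain ⟨F', hdet, hF'⟩ := hasStrictFDerivAt_sum_smul_curve
    (fun i => htv i ▸ (hφat _ (ht i)).hasStrictDerivAt one_ne_zero) hv
    (w := fun i => (2⁻¹ : ℝ) ^ ((i : ℕ) + 1)) (fun i => by positivity) ((2⁻¹ : ℝ) ^ n • φ z)
  obtain ⟨K, hKsub, hK, hKpos⟩ := exists_isCompact_subset_image_measure_pos volume hF' hdet
    (P := univ.pi fun _ => Z) (by
      intro U hU
      obtain ⟨r, hr, hrU⟩ := Metric.mem_nhds_iff.1 hU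
      refine ⟨univ.pi fun i => Z ∩ Ioo (max a (t i - r)) (min b (t i + r)), fun s hs =>
        ⟨fun i _ => (hs i trivial).1, hrU ?_⟩, MeasurableSet.univ_pi fun i =>
          hZmeas.inter measurableSet_Ioo, ?_⟩
      · rw [Metric.mem_ball, dist_pi_lt_iff hr]
        intro i
        obtain ⟨h1, h2⟩ := (hs i trivial).2
        rw [max_lt_iff] at h1
        rw [lt_min_iff] at h2
        rw [Real.dist_eq, abs_lt]
        constructor <;> linarith
      · rw [volume_pi_pi, CanonicallyOrderedAdd.prod_pos]
        intro i _
        refine hZ _ _ (le_max_left _ _) ?_ (min_le_left _ _)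
        obtain ⟨h1, h2⟩ := ht i
        rw [max_lt_iff, lt_min_iff, lt_min_iff]
        refine ⟨⟨hab, ?_⟩, ?_, ?_⟩ <;> linarith)
  let S : Set (Fin n → ℝ) := {x | x ∈ D ∧ f x ≤ M}
  have hS : ∀ x ∈ S, ∀ y ∈ S, (2 : ℝ)⁻¹ • (x + y) ∈ S := by
    rintro x ⟨hxD, hx⟩ y ⟨hyD, hy⟩
    refine ⟨?_, (hf x hxD y hyD).trans (by linarith)⟩
    rw [smul_add]
    exact hDconv hxD hyD (by norm_num) (by norm_num) (by norm_num)
  have hZS : ∀ s ∈ Z, φ s ∈ S := fun s hs =>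
    ⟨hZD (mem_image_of_mem φ hs), hM (mem_image_of_mem f (mem_image_of_mem φ hs))⟩
  have hKS : K ⊆ S := by
    intro x hx
    obtain ⟨s, hs, rfl⟩ := hKsub hx
    exact sum_dyadic_mem_of_midpoint_mem hS _ (fun i => hZS _ (hs i trivial)) (hZS z hz)
  obtain ⟨c, hc⟩ := exists_add_self_mem_nhds volume hK.measurableSet hKpos
  refine midconvex_continuousOn_of_eventually_le hD hDconv hf (p := (2 : ℝ)⁻¹ • c) (M := M) ?_
  filter_upwards [smul_mem_nhds_smul₀ (inv_ne_zero (two_ne_zero (α := ℝ))) hc] with p hp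
  obtain ⟨_, ⟨x, hx, y, hy, rfl⟩, rfl⟩ := hp
  exact hS x (hKS hx) y (hKS hy)
end

section
/- Let n ≥ 2, let a < b be real numbers, and let φ : ℝ → ℝⁿ be continuously differentiable on [a, b] such that the affine span of φ([a, b]) equals all of ℝⁿ. Let Z ⊆ [a, b] be a measurable set of positive Lebesgue measure, and assume that for almost every (x₁, …, xₙ) ∈ [a, b]ⁿ (with respect to n-dimensional Lebesgue measure) the determinant of the n × n matrix whose j-th column is the derivative φ′(xⱼ) is non-zero. Then for every open convex set D ⊆ ℝⁿ containing φ(Z) and every mid-convex function f : D → ℝ that is bounded above on φ(Z), the function f is continuous on D. -/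
open MeasureTheory Set Filter Topology

/-- A function is mid-convex on `D` if `f ((x + y) / 2) ≤ (f x + f y) / 2` on `D`. -/
def MidConvexOn {E : Type*} [AddCommGroup E] [Module ℝ E] (D : Set E) (f : E → ℝ) : Prop :=
  ∀ x ∈ D, ∀ y ∈ D, f ((2 : ℝ)⁻¹ • (x + y)) ≤ (f x + f y) / 2

theorem Convex.half_smul_add_mem {E : Type*} [AddCommGroup E] [Module ℝ E] {D : Set E}
    (hD : Convex ℝ D) {x y : E} (hx : x ∈ D) (hy : y ∈ D) : (2 : ℝ)⁻¹ • (x + y) ∈ D := by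
  rw [smul_add]
  exact hD hx hy (by norm_num) (by norm_num) (by norm_num)

namespace MidConvexOn

variable {E : Type*}

theorem le_dyadic [AddCommGroup E] [Module ℝ E] {D : Set E} {f : E → ℝ}
    (hf : MidConvexOn D f) (hD : Convex ℝ D) {x y : E} (hx : x ∈ D) (hy : y ∈ D) (k : ℕ) :
    f (((2 : ℝ) ^ k)⁻¹ • x + (1 - ((2 : ℝ) ^ k)⁻¹) • y) ≤
      ((2 : ℝ) ^ k)⁻¹ * f x + (1 - ((2 : ℝ) ^ k)⁻¹) * f y := by
  induction k with
  | zero => simp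
  | succ k ih =>
    have hk : ((2 : ℝ) ^ k)⁻¹ ≤ 1 := inv_le_one_of_one_le₀ (one_le_pow₀ (by norm_num))
    have hmem : ((2 : ℝ) ^ k)⁻¹ • x + (1 - ((2 : ℝ) ^ k)⁻¹) • y ∈ D :=
      hD hx hy (by positivity) (by linarith) (by ring)
    have h := hf _ hmem _ hy
    have e : (2 : ℝ)⁻¹ • (((2 : ℝ) ^ k)⁻¹ • x + (1 - ((2 : ℝ) ^ k)⁻¹) • y + y) =
        ((2 : ℝ) ^ (k + 1))⁻¹ • x + (1 - ((2 : ℝ) ^ (k + 1))⁻¹) • y := by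
      rw [pow_succ, mul_inv]; module
    rw [e] at h
    refine h.trans ?_
    rw [pow_succ, mul_inv]
    linarith

variable [NormedAddCommGroup E] [NormedSpace ℝ E] {D : Set E} {f : E → ℝ}

theorem continuousAt_of_eventually_le (hf : MidConvexOn D f) (hD : Convex ℝ D)
    (hDo : IsOpen D) {x : E} (hx : x ∈ D) {M : ℝ} (hM : ∀ᶠ y in 𝓝 x, f y ≤ M) :
    ContinuousAt f x := by
  obtain ⟨r, hr, hball⟩ := Metric.eventually_nhds_iff.1 (hM.and (hDo.mem_nhds hx))
  rw [Metric.continuousAt_iff]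
  intro ε hε
  have hlim : Tendsto (fun k : ℕ => ((2 : ℝ) ^ k)⁻¹ * (M - f x)) atTop (𝓝 0) := by
    simpa using (tendsto_inv_atTop_zero.comp
      (tendsto_pow_atTop_atTop_of_one_lt (one_lt_two (α := ℝ)))).mul_const (M - f x)
  obtain ⟨k, hk⟩ := (hlim.eventually (gt_mem_nhds hε)).exists
  have h2 : (0 : ℝ) < 2 ^ k := by positivity
  have upper : ∀ h : E, ‖h‖ < r / 2 ^ k → f (x + h) - f x < ε := by
    intro h hh
    have hd : dist (x + (2 : ℝ) ^ k • h) x < r := by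
      rw [dist_eq_norm, add_sub_cancel_left, norm_smul, Real.norm_of_nonneg h2.le]
      rwa [lt_div_iff₀' h2] at hh
    obtain ⟨hle, hmem⟩ := hball hd
    have hdy := hf.le_dyadic hD hmem hx k
    have e : ((2 : ℝ) ^ k)⁻¹ • (x + (2 : ℝ) ^ k • h) + (1 - ((2 : ℝ) ^ k)⁻¹) • x = x + h := by
      rw [smul_add, smul_smul, inv_mul_cancel₀ h2.ne']; module
    rw [e] at hdy
    have := mul_le_mul_of_nonneg_left hle (inv_pos.2 h2).le
    linarith
  refine ⟨r / 2 ^ k, by positivity, fun {y} hy => ?_⟩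
  rw [dist_eq_norm] at hy
  have h2k : r / 2 ^ k ≤ r := div_le_self hr.le (one_le_pow₀ (by norm_num))
  have h₁ := upper (y - x) hy
  have h₂ := upper (x - y) (by rwa [norm_sub_rev])
  have hyD : y ∈ D := (hball (by rw [dist_eq_norm]; linarith)).2
  have hzD : x + (x - y) ∈ D :=
    (hball (by rw [dist_eq_norm, add_sub_cancel_left, norm_sub_rev]; linarith)).2
  have h₃ := hf _ hyD _ hzD
  have e : (2 : ℝ)⁻¹ • (y + (x + (x - y))) = x := by module
  rw [e] at h₃
  rw [add_sub_cancel] at h₁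
  rw [Real.dist_eq, abs_lt]
  constructor <;> linarith

theorem exists_eventually_le (hf : MidConvexOn D f) (hD : Convex ℝ D) (hDo : IsOpen D)
    {p : E} (hp : p ∈ D) {M : ℝ} (hM : ∀ᶠ y in 𝓝 p, f y ≤ M) {x : E} (hx : x ∈ D) :
    ∃ M', ∀ᶠ y in 𝓝 x, f y ≤ M' := by
  have hlim : Tendsto (fun k : ℕ => x + ((2 : ℝ) ^ k - 1)⁻¹ • (x - p)) atTop (𝓝 x) := by
    have h1 : Tendsto (fun k : ℕ => ((2 : ℝ) ^ k - 1)⁻¹) atTop (𝓝 0) :=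
      tendsto_inv_atTop_zero.comp (tendsto_atTop_add_const_right _ (-1)
        (tendsto_pow_atTop_atTop_of_one_lt (one_lt_two (α := ℝ))))
    simpa using (h1.smul_const (x - p)).const_add x
  obtain ⟨k, hk, hk0⟩ :=
    ((hlim.eventually (hDo.mem_nhds hx)).and (eventually_gt_atTop 0)).exists
  set y := x + ((2 : ℝ) ^ k - 1)⁻¹ • (x - p) with hy
  have h2 : (0 : ℝ) < 2 ^ k := by positivity
  have h21 : (1 : ℝ) < 2 ^ k := one_lt_pow₀ (by norm_num) hk0.ne'
  have hxy : x = ((2 : ℝ) ^ k)⁻¹ • p + (1 - ((2 : ℝ) ^ k)⁻¹) • y := by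
    have h3 : (2 : ℝ) ^ k - 1 ≠ 0 := by linarith
    have h4 : (1 - ((2 : ℝ) ^ k)⁻¹) * ((2 : ℝ) ^ k - 1)⁻¹ = ((2 : ℝ) ^ k)⁻¹ := by
      field_simp
    rw [hy, smul_add, smul_smul, h4]
    module
  have hback : Tendsto (fun z : E => p + (2 : ℝ) ^ k • (z - x)) (𝓝 x) (𝓝 p) := by
    have : Continuous fun z : E => p + (2 : ℝ) ^ k • (z - x) := by fun_prop
    simpa using this.tendsto x
  refine ⟨((2 : ℝ) ^ k)⁻¹ * M + (1 - ((2 : ℝ) ^ k)⁻¹) * f y, ?_⟩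
  filter_upwards [hback.eventually (hM.and (hDo.mem_nhds hp))] with z hz
  have hdy := hf.le_dyadic hD hz.2 hk k
  have e : ((2 : ℝ) ^ k)⁻¹ • (p + (2 : ℝ) ^ k • (z - x)) + (1 - ((2 : ℝ) ^ k)⁻¹) • y = z := by
    rw [smul_add, smul_smul, inv_mul_cancel₀ h2.ne', one_smul, add_right_comm, ← hxy]
    abel
  rw [e] at hdy
  have := mul_le_mul_of_nonneg_left hz.1 (inv_pos.2 h2).le
  linarith

/-- The **Bernstein–Doetsch theorem**: a mid-convex function on an open convex set which is bounded
above near some point is continuous. -/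
theorem continuousOn_of_eventually_le (hf : MidConvexOn D f) (hD : Convex ℝ D)
    (hDo : IsOpen D) {p : E} (hp : p ∈ D) {M : ℝ} (hM : ∀ᶠ y in 𝓝 p, f y ≤ M) :
    ContinuousOn f D := by
  intro x hx
  obtain ⟨M', hM'⟩ := hf.exists_eventually_le hD hDo hp hM hx
  exact (hf.continuousAt_of_eventually_le hD hDo hx hM').continuousWithinAt

end MidConvexOn

section Steinhaus

variable {E : Type*} [NormedAddCommGroup E] [NormedSpace ℝ E] [FiniteDimensional ℝ E]
  [MeasurableSpace E] [BorelSpace E] (μ : Measure E) [μ.IsAddHaarMeasure]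

theorem exists_measure_inter_reflection_pos {A : Set E} (hA : MeasurableSet A) (hpos : μ A ≠ 0) :
    ∃ c : E, μ (A ∩ {y | c - y ∈ A}) ≠ 0 := by
  by_contra! h
  have hmp := measurePreserving_prod_sub_swap μ μ
  have hnull : (μ.prod μ) ((fun z : E × E => (z.2, z.1 - z.2)) ⁻¹' (A ×ˢ A)) = 0 := by
    rw [Measure.measure_prod_null (hmp.measurable (hA.prod hA))]
    exact Eventually.of_forall h
  rw [hmp.measure_preimage (hA.prod hA).nullMeasurableSet, Measure.prod_prod] at hnull
  exact hpos (by simpa using hnull)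

/-- The midpoints of a set of positive measure form a neighbourhood of some point. -/
theorem exists_eventually_midpoint {A : Set E} (hA : MeasurableSet A) (hpos : μ A ≠ 0) :
    ∃ p : E, ∀ᶠ z in 𝓝 p, ∃ x ∈ A, ∃ y ∈ A, (2 : ℝ)⁻¹ • (x + y) = z := by
  obtain ⟨c, hc⟩ := exists_measure_inter_reflection_pos μ hA hpos
  have hB : MeasurableSet (A ∩ {y | c - y ∈ A}) :=
    hA.inter ((measurable_const.sub measurable_id) hA)
  have hS := Measure.sub_mem_nhds_zero_of_addHaar_pos μ _ hB (pos_iff_ne_zero.2 hc)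
  refine ⟨(2 : ℝ)⁻¹ • c, ?_⟩
  have ht : Tendsto (fun z : E => (2 : ℝ) • z - c) (𝓝 ((2 : ℝ)⁻¹ • c)) (𝓝 0) := by
    have : Continuous fun z : E => (2 : ℝ) • z - c := by fun_prop
    simpa using this.tendsto ((2 : ℝ)⁻¹ • c)
  filter_upwards [ht hS] with z hz
  obtain ⟨u, hu, v, hv, huv⟩ := Set.mem_sub.1 hz
  refine ⟨u, hu.1, c - v, hv.2, ?_⟩
  rw [← add_sub_assoc, add_sub_right_comm, huv, sub_add_cancel, smul_smul]
  simp

/-- A map which is `C¹` with invertible derivative at the points of a set of positive measure maps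
this set to a set of positive measure. -/
theorem measure_image_ne_zero_of_contDiffAt {F : E → E} {T : Set E} (hT : μ T ≠ 0)
    (hF : ∀ x ∈ T, ContDiffAt ℝ 1 F x)
    (hF' : ∀ x ∈ T, ∃ F' : E ≃L[ℝ] E, HasFDerivAt F (F' : E →L[ℝ] E) x) :
    μ (F '' T) ≠ 0 := by
  intro hnull
  obtain ⟨x, hxT, hx⟩ := exists_mem_forall_mem_nhdsWithin_pos_measure hT
  obtain ⟨F', hFx⟩ := hF' x hxT
  have hC := hF x hxT
  set g := hC.localInverse hFx one_ne_zero with hg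
  have hgC : ContDiffAt ℝ 1 g (F x) := hC.to_localInverse hFx one_ne_zero
  have hleft : ∀ᶠ y in 𝓝 x, g (F y) = y :=
    (hC.hasStrictFDerivAt' hFx one_ne_zero).eventually_left_inverse
  have hdiff : ∀ᶠ z in 𝓝 (F x), DifferentiableAt ℝ g z :=
    (hgC.eventually (by simp)).mono fun z hz => hz.differentiableAt one_ne_zero
  have hW : {y | g (F y) = y ∧ DifferentiableAt ℝ g (F y)} ∈ 𝓝 x :=
    hleft.and (hC.continuousAt.eventually hdiff)
  refine (hx _ (inter_mem self_mem_nhdsWithin (mem_nhdsWithin_of_mem_nhds hW))).ne' ?_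
  have himg : μ (g '' (F '' T ∩ {z | DifferentiableAt ℝ g z})) = 0 :=
    addHaar_image_eq_zero_of_differentiableOn_of_addHaar_eq_zero μ
      (fun z hz => hz.2.differentiableWithinAt) (measure_mono_null inter_subset_left hnull)
  refine measure_mono_null ?_ himg
  rintro y ⟨hyT, hy, hyd⟩
  exact ⟨F y, ⟨mem_image_of_mem F hyT, hyd⟩, hy⟩

end Steinhaus

/-- A set closed under midpoints is closed under the convex combinations with weights
`2⁻¹, 2⁻², …, 2⁻ⁿ, 2⁻ⁿ`. -/
theorem dyadic_sum_mem_of_midpoint_mem {E : Type*} [AddCommGroup E] [Module ℝ E] {S : Set E}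
    (hS : ∀ x ∈ S, ∀ y ∈ S, (2 : ℝ)⁻¹ • (x + y) ∈ S) {z : E} (hz : z ∈ S) {n : ℕ}
    (v : Fin n → E) (hv : ∀ j, v j ∈ S) :
    (∑ j : Fin n, ((2 : ℝ) ^ (j.val + 1))⁻¹ • v j) + ((2 : ℝ) ^ n)⁻¹ • z ∈ S := by
  induction n with
  | zero => simpa using hz
  | succ n ih =>
    have h := hS _ (hv 0) _ (ih (fun j => v j.succ) fun j => hv _)
    convert h using 1
    rw [Fin.sum_univ_succ, smul_add, smul_add, Finset.smul_sum]
    simp only [smul_smul, Fin.val_succ, Fin.val_zero, zero_add, pow_one, pow_succ _ (_ + 1),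
      pow_succ _ n, mul_inv_rev]
    rw [add_assoc]

/-- The weighted sum of the points of a curve `φ` has an invertible derivative wherever the
velocities are linearly independent. -/
theorem exists_hasFDerivAt_weighted_sum {n : ℕ} {φ : ℝ → Fin n → ℝ} {w : Fin n → ℝ}
    (hw : ∀ j, w j ≠ 0) (c : Fin n → ℝ) {x : Fin n → ℝ}
    (hφ : ∀ j, DifferentiableAt ℝ φ (x j))
    (hdet : (Matrix.of fun i j => deriv φ (x j) i).det ≠ 0) :
    ∃ F' : (Fin n → ℝ) ≃L[ℝ] (Fin n → ℝ),
      HasFDerivAt (fun y : Fin n → ℝ => (∑ j, w j • φ (y j)) + c)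
        (F' : (Fin n → ℝ) →L[ℝ] (Fin n → ℝ)) x := by
  set M : Matrix (Fin n) (Fin n) ℝ := Matrix.of fun i j => deriv φ (x j) i with hM
  set L : (Fin n → ℝ) →L[ℝ] (Fin n → ℝ) :=
    LinearMap.toContinuousLinearMap (Matrix.toLin' (M * Matrix.diagonal w)) with hL
  have hLdet : L.det ≠ 0 := by
    rw [ContinuousLinearMap.det, hL, LinearMap.coe_toContinuousLinearMap, LinearMap.det_toLin',
      Matrix.det_mul, Matrix.det_diagonal]
    exact mul_ne_zero hdet (Finset.prod_ne_zero_iff.2 fun j _ => hw j)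
  refine ⟨L.toContinuousLinearEquivOfDetNeZero hLdet, ?_⟩
  rw [ContinuousLinearMap.coe_toContinuousLinearEquivOfDetNeZero]
  have h : HasFDerivAt (fun y : Fin n → ℝ => (∑ j, w j • φ (y j)) + c)
      (∑ j, w j • (ContinuousLinearMap.toSpanSingleton ℝ (deriv φ (x j))).comp
        (ContinuousLinearMap.proj (R := ℝ) (φ := fun _ : Fin n => ℝ) j)) x := by
    refine (HasFDerivAt.fun_sum fun j _ => HasFDerivAt.const_smul ?_ (w j)).add_const c
    exact (hφ j).hasDerivAt.hasFDerivAt.comp x (hasFDerivAt_apply j x)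
  refine h.congr_fderiv (ContinuousLinearMap.ext fun v => funext fun i => ?_)
  simp [hL, hM, Matrix.toLin'_apply, Matrix.mulVec, dotProduct, Finset.sum_apply,
    Matrix.diagonal_apply]
  exact Finset.sum_congr rfl fun j _ => by ring

theorem ger_curve_determinant_version
    {n : ℕ} (hn : 2 ≤ n) (a b : ℝ) (hab : a < b)
    (φ : ℝ → (Fin n → ℝ)) (hφ : ContDiffOn ℝ 1 φ (Icc a b))
    (hspan : affineSpan ℝ (φ '' Icc a b) = ⊤)
    (Z : Set ℝ) (hZab : Z ⊆ Icc a b) (hZmeas : MeasurableSet Z)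
    (hZ : 0 < volume Z)
    (hdet : ∀ᵐ x ∂(volume : Measure (Fin n → ℝ)),
      (∀ j, x j ∈ Icc a b) → (Matrix.of fun i j => deriv φ (x j) i).det ≠ 0)
    (D : Set (Fin n → ℝ)) (hD : IsOpen D) (hDconv : Convex ℝ D) (hZD : φ '' Z ⊆ D)
    (f : (Fin n → ℝ) → ℝ)
    (hf : ∀ x ∈ D, ∀ y ∈ D, f ((2 : ℝ)⁻¹ • (x + y)) ≤ (f x + f y) / 2)
    (hbdd : BddAbove (f '' (φ '' Z))) :
    ContinuousOn f D := by
  set Z' := Z ∩ Ioo a b with hZ'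
  have hZ'pos : 0 < volume Z' := by
    have hsub : Z ⊆ Z' ∪ {a, b} := fun t ht => by
      by_cases h : t ∈ Ioo a b
      · exact Or.inl ⟨ht, h⟩
      · right
        rcases eq_endpoints_or_mem_Ioo_of_mem_Icc (hZab ht) with h' | h' | h'
        · exact Or.inl h'
        · exact Or.inr h'
        · exact absurd h' h
    have hle := (measure_mono hsub).trans (measure_union_le (μ := volume) Z' {a, b})
    rw [((Set.toFinite {a, b}).measure_zero volume : volume ({a, b} : Set ℝ) = 0), add_zero] at hle
    exact hZ.trans_le hle
  obtain ⟨K, hKZ, hK, hKpos⟩ :=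
    (hZmeas.inter measurableSet_Ioo : MeasurableSet Z').exists_lt_isCompact hZ'pos
  obtain ⟨M, hM⟩ := hbdd
  obtain ⟨z₀, hz₀⟩ : Z.Nonempty := nonempty_of_measure_ne_zero hZ.ne'
  have hmid : MidConvexOn D f := hf
  set S : Set (Fin n → ℝ) := {x | x ∈ D ∧ f x ≤ M} with hS
  have hSmid : ∀ x ∈ S, ∀ y ∈ S, (2 : ℝ)⁻¹ • (x + y) ∈ S := fun x hx y hy =>
    ⟨hDconv.half_smul_add_mem hx.1 hy.1, by linarith [hf x hx.1 y hy.1, hx.2, hy.2]⟩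
  have hφS : ∀ t ∈ Z, φ t ∈ S := fun t ht =>
    ⟨hZD (mem_image_of_mem φ ht), hM (mem_image_of_mem f (mem_image_of_mem φ ht))⟩
  set F : (Fin n → ℝ) → (Fin n → ℝ) := fun x =>
    (∑ j : Fin n, ((2 : ℝ) ^ (j.val + 1))⁻¹ • φ (x j)) + ((2 : ℝ) ^ n)⁻¹ • φ z₀ with hF
  have hKn : IsCompact (Set.pi univ fun _ : Fin n => K) := isCompact_univ_pi fun _ => hK
  have hφC : ∀ t ∈ K, ContDiffAt ℝ 1 φ t := fun t ht =>
    hφ.contDiffAt (Icc_mem_nhds (hKZ ht).2.1 (hKZ ht).2.2)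
  have hFC : ∀ x ∈ Set.pi univ (fun _ : Fin n => K), ContDiffAt ℝ 1 F x := fun x hx => by
    have hj : ∀ j : Fin n,
        ContDiffAt ℝ 1 (fun y : Fin n → ℝ => ((2 : ℝ) ^ (j.val + 1))⁻¹ • φ (y j)) x := fun j =>
      ((hφC _ (hx j (mem_univ j))).comp x (contDiffAt_apply ℝ ℝ j x)).const_smul _
    exact (ContDiffAt.sum fun j _ => hj j).add contDiffAt_const
  have hAS : F '' (Set.pi univ fun _ : Fin n => K) ⊆ S := by
    rintro _ ⟨x, hx, rfl⟩
    exact dyadic_sum_mem_of_midpoint_mem hSmid (hφS z₀ hz₀) (fun j => φ (x j))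
      fun j => hφS _ (hKZ (hx j (mem_univ j))).1
  have hAmeas : MeasurableSet (F '' (Set.pi univ fun _ : Fin n => K)) :=
    (hKn.image_of_continuousOn
      fun x hx => (hFC x hx).continuousAt.continuousWithinAt).measurableSet
  have hApos : volume (F '' (Set.pi univ fun _ : Fin n => K)) ≠ 0 := by
    set T := (Set.pi univ fun _ : Fin n => K) ∩
      {x | (Matrix.of fun i j => deriv φ (x j) i).det ≠ 0} with hT
    have hTpos : volume T ≠ 0 := by
      have hTae : T =ᵐ[volume] Set.pi univ fun _ : Fin n => K := by
        filter_upwards [hdet] with x hx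
        exact propext ⟨fun h => h.1, fun h =>
          ⟨h, hx fun j => hZab (hKZ (h j (mem_univ j))).1⟩⟩
      rw [measure_congr hTae, volume_pi_pi]
      exact Finset.prod_ne_zero_iff.2 fun _ _ => hKpos.ne'
    refine fun h => measure_image_ne_zero_of_contDiffAt volume hTpos (fun x hx => hFC x hx.1)
      (fun x hx => ?_) (measure_mono_null (image_mono inter_subset_left) h)
    exact exists_hasFDerivAt_weighted_sum (fun j => by positivity) _
      (fun j => (hφC _ (hx.1 j (mem_univ j))).differentiableAt one_ne_zero) hx.2
  obtain ⟨p, hp⟩ := exists_eventually_midpoint volume hAmeas hApos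
  have hpS : ∀ᶠ z in 𝓝 p, z ∈ S := hp.mono fun z ⟨x, hx, y, hy, hxy⟩ =>
    hxy ▸ hSmid x (hAS hx) y (hAS hy)
  exact hmid.continuousOn_of_eventually_le hDconv hD hpS.self_of_nhds.1 (hpS.mono fun z hz => hz.2)
end
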